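/- arXiv:2008.10133 — 10 statements merged into one kernel-verified Lean document; each statement's English description precedes it below -/
import Mathlib

section
/- Let V be a finite-dimensional real inner product space, R ⊆ V a finite set of nonzero vectors, and D ⊆ V a linear subspace. Set R_D := {α ∈ R : ⟨α,x⟩ = 0 for all x ∈ D}, and assume that the linear span of R_D equals the orthogonal complement D^⊥. Let β ∈ R be such that the functional x ↦ ⟨β,x⟩ is not identically zero on D, and set R_{D,β} := span(R_D ∪ {β}) ∩ R. Assume R_{D,β} is a union of pairwise disjoint subsets R^{(0)}, R^{(1)}, …, R^{(p)} such that ⟨α,γ⟩ = 0 whenever α ∈ R^{(i)}, γ ∈ R^{(j)} with i ≠ j, that β ∈ R^{(0)}, and that R^{(i)} ⊆ R_D for every i ≥ 1. If β̃ ∈ R satisfies ⟨β̃,x⟩ = c·⟨β,x⟩ for all x ∈ D, for some scalar c ≠ 0, then β̃ ∈ R^{(0)}. -/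
open scoped RealInnerProductSpace

theorem stmt1 {V : Type*} [NormedAddCommGroup V] [InnerProductSpace ℝ V]
    [FiniteDimensional ℝ V]
    (R : Set V) (hRfin : R.Finite) (hR0 : ∀ α ∈ R, α ≠ 0)
    (D : Submodule ℝ V)
    (RD : Set V) (hRD : RD = {α ∈ R | ∀ x ∈ D, ⟪α, x⟫ = 0})
    (hspan : Submodule.span ℝ RD = Dᗮ)
    (β : V) (hβR : β ∈ R) (hβD : ∃ x ∈ D, ⟪β, x⟫ ≠ 0)
    (RDβ : Set V)
    (hRDβ : RDβ = (Submodule.span ℝ (RD ∪ {β}) : Set V) ∩ R)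
    (p : ℕ) (Rsub : Fin (p + 1) → Set V)
    (hcover : RDβ = ⋃ i, Rsub i)
    (hdisj : ∀ i j, i ≠ j → Disjoint (Rsub i) (Rsub j))
    (horth : ∀ i j, i ≠ j → ∀ α ∈ Rsub i, ∀ γ ∈ Rsub j, ⟪α, γ⟫ = 0)
    (hβ0 : β ∈ Rsub 0)
    (hsubRD : ∀ i : Fin (p + 1), i ≠ 0 → Rsub i ⊆ RD)
    (βt : V) (hβt : βt ∈ R) (c : ℝ) (hc : c ≠ 0)
    (hprop : ∀ x ∈ D, ⟪βt, x⟫ = c * ⟪β, x⟫) :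
    βt ∈ Rsub 0 := by
  have hD : βt - c • β ∈ Dᗮ := by
    rw [Submodule.mem_orthogonal']
    intro x hx
    rw [inner_sub_left, real_inner_smul_left, hprop x hx, sub_self]
  rw [← hspan] at hD
  have hmem : βt ∈ Submodule.span ℝ (RD ∪ {β}) := by
    rw [← sub_add_cancel βt (c • β)]
    exact add_mem (Submodule.span_mono Set.subset_union_left hD)
      (Submodule.smul_mem _ c (Submodule.subset_span (Or.inr rfl)))
  have hβt' : βt ∈ ⋃ i, Rsub i := by
    rw [← hcover, hRDβ]
    exact ⟨hmem, hβt⟩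
  obtain ⟨i, hi⟩ := Set.mem_iUnion.mp hβt'
  by_cases h0 : i = 0
  · exact h0 ▸ hi
  · have hRDmem := hsubRD i h0 hi
    rw [hRD] at hRDmem
    obtain ⟨x, hx, hβx⟩ := hβD
    exact absurd ((hprop x hx).symm.trans (hRDmem.2 x hx)) (mul_ne_zero hc hβx)
end

section
/- Let d ≥ 1, let m₀,…,m_d be positive integers with n + 1 := m₀ + ⋯ + m_d, let ξ₀,…,ξ_d ∈ ℂ be pairwise distinct, and let λ(X) := ∏_{i=0}^d (X − ξᵢ)^{mᵢ}. Suppose q₁,…,q_d ∈ ℂ are pairwise distinct, satisfy ξ_a ≠ qᵢ for all a ∈ {0,…,d} and i ∈ {1,…,d}, and satisfy λ′(X) = (n+1)·∏_{i=0}^d (X − ξᵢ)^{mᵢ−1}·∏_{j=1}^d (X − q_j). Let A be the d×d matrix with entries A_{i,a} = 1/(ξ_a − qᵢ) for i,a ∈ {1,…,d}. Then ∏_{i=1}^d λ″(qᵢ) = κ · (det A)² · ∏_{0≤i<j≤d} (ξᵢ − ξ_j)^{mᵢ+m_j}, where κ = (−1)^{∑_{i=1}^d i·mᵢ + n·d}·(n+1)^{−n}·(∏_{a=1}^d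 m_a²)·(∏_{a=0}^d m_a^{m_a−1}). (This identity expresses the determinant of the restricted Saito metric on an A_n discriminant stratum in the coordinates ξ₁,…,ξ_d.) -/
open Polynomial

section Products

variable {R : Type*} [CommRing R] {d : ℕ}

theorem prod_pow_prod_compl_sub (x : Fin d → R) (k : Fin d → ℕ) :
    ∏ a, (∏ b ∈ {a}ᶜ, (x a - x b)) ^ k a =
      (-1) ^ (∑ a : Fin _, (a : ℕ) * k a) *
        ∏ a, ∏ b ∈ Finset.Ioi a, (x a - x b) ^ (k a + k b) := by
  have hsign : (-1 : R) ^ (∑ a : Fin d, (a : ℕ) * k a) =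
      ∏ a : Fin d, ∏ b ∈ Finset.Ioi a, (-1) ^ k b := by
    rw [Finset.prod_comm' (t' := Finset.univ) (s' := fun b => Finset.Iio b) (by simp),
      ← Finset.prod_pow_eq_pow_sum]
    refine Finset.prod_congr rfl fun b _ => ?_
    rw [Finset.prod_const, Fin.card_Iio, ← pow_mul, mul_comm]
  have h := Finset.prod_prod_Ioi_mul_eq_prod_prod_off_diag
    (fun j i : Fin d => (x i - x j) ^ k i)
  simp_rw [← Finset.prod_pow]
  rw [← h, hsign]
  simp_rw [← Finset.prod_mul_distrib]
  refine Finset.prod_congr rfl fun a _ => Finset.prod_congr rfl fun b _ => ?_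
  rw [← neg_sub (x a) (x b), neg_pow, pow_add]
  ring

theorem prod_prod_compl_sub (x : Fin d → R) :
    ∏ a, ∏ b ∈ {a}ᶜ, (x a - x b) =
      (-1) ^ (∑ a : Fin d, (a : ℕ)) * (∏ a, ∏ b ∈ Finset.Ioi a, (x a - x b)) ^ 2 := by
  simpa [Finset.prod_pow] using prod_pow_prod_compl_sub x fun _ => 1

theorem prod_prod_Ioi_sub_ne_zero {K : Type*} [Field K] {x : Fin d → K}
    (hx : Function.Injective x) : ∏ a, ∏ b ∈ Finset.Ioi a, (x a - x b) ≠ 0 :=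
  Finset.prod_ne_zero_iff.2 fun _ _ => Finset.prod_ne_zero_iff.2 fun _ hb =>
    sub_ne_zero.2 (hx.ne (Finset.mem_Ioi.1 hb).ne)

theorem sq_prod_prod_Ioi_sub_comm (x : Fin d → R) :
    (∏ a, ∏ b ∈ Finset.Ioi a, (x b - x a)) ^ 2 =
      (∏ a, ∏ b ∈ Finset.Ioi a, (x a - x b)) ^ 2 := by
  simp_rw [← Finset.prod_pow]
  exact Finset.prod_congr rfl fun a _ => Finset.prod_congr rfl fun b _ => by ring

end Products

section Cauchy

variable {K : Type*} [Field K] {d : ℕ}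

/-- Interpolation at the nodes `y` factors through a Vandermonde matrix. -/
theorem exists_prod_compl_sub_eq_vandermonde_mul (y : Fin d → K) :
    ∃ M : Matrix (Fin d) (Fin d) K, ∀ z : Fin d → K,
      Matrix.of (fun a i => ∏ j ∈ {i}ᶜ, (z a - y j)) = Matrix.vandermonde z * M := by
  refine ⟨Matrix.of fun l i => (∏ j ∈ {i}ᶜ, (X - C (y j))).coeff l, fun z => ?_⟩
  ext a i
  have hdeg : (∏ j ∈ ({i}ᶜ : Finset (Fin d)), (X - C (y j))).natDegree < d := by
    rw [natDegree_finsetProd_X_sub_C_eq_card, Finset.card_compl]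
    have := i.pos
    simp [this]
  have h := eval_eq_sum_range' hdeg (z a)
  rw [eval_prod, Finset.sum_range] at h
  simpa [Matrix.mul_apply, Matrix.vandermonde_apply, mul_comm] using h

/-- The square of the Cauchy determinant. -/
theorem sq_prod_mul_sq_det_cauchy (y z : Fin d → K) (hy : Function.Injective y)
    (hzy : ∀ a i, z a ≠ y i) :
    (∏ a, ∏ j, (z a - y j)) ^ 2 *
        (Matrix.of fun i a : Fin d => 1 / (z a - y i)).det ^ 2 =
      (∏ a, ∏ b ∈ Finset.Ioi a, (z a - z b)) ^ 2 *
        (∏ a, ∏ b ∈ Finset.Ioi a, (y a - y b)) ^ 2 := by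
  obtain ⟨M, hM⟩ := exists_prod_compl_sub_eq_vandermonde_mul y
  have hV := prod_prod_Ioi_sub_ne_zero hy
  have hsq : ((-1 : K) ^ (∑ a : Fin d, (a : ℕ))) ^ 2 = 1 := by
    rw [← pow_mul, mul_comm, pow_mul]; simp
  have hdetM : M.det ^ 2 = (∏ a, ∏ b ∈ Finset.Ioi a, (y a - y b)) ^ 2 := by
    have hdiag : Matrix.of (fun a i => ∏ j ∈ {i}ᶜ, (y a - y j)) =
        Matrix.diagonal fun a => ∏ j ∈ {a}ᶜ, (y a - y j) := by
      ext a i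
      rcases eq_or_ne a i with rfl | hai
      · simp
      · rw [Matrix.diagonal_apply_ne _ hai]
        exact Finset.prod_eq_zero (by simpa using hai : a ∈ ({i}ᶜ : Finset _)) (sub_self _)
    have h := congrArg (fun N => N.det ^ 2) (hdiag.symm.trans (hM y))
    simp only [Matrix.det_diagonal, Matrix.det_mul, Matrix.det_vandermonde, mul_pow,
      sq_prod_prod_Ioi_sub_comm, prod_prod_compl_sub, hsq, one_mul] at h
    refine mul_left_cancel₀ (pow_ne_zero 2 hV) (h.symm.trans ?_)
    ring
  have hrow : Matrix.of (fun a i => ∏ j ∈ {i}ᶜ, (z a - y j)) =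
      Matrix.of fun a i => (∏ j, (z a - y j)) *
        (Matrix.of fun i a : Fin d => 1 / (z a - y i)).transpose a i := by
    ext a i
    have : z a - y i ≠ 0 := sub_ne_zero.2 (hzy a i)
    simp only [Matrix.of_apply, Matrix.transpose_apply]
    rw [← Finset.prod_compl_mul_prod {i}, Finset.prod_singleton]
    field_simp
  have h := congrArg (fun N => N.det ^ 2) (hrow.symm.trans (hM z))
  simpa only [Matrix.det_mul_column, Matrix.det_transpose, Matrix.det_mul,
    Matrix.det_vandermonde, mul_pow, sq_prod_prod_Ioi_sub_comm, hdetM] using h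

end Cauchy

/-- If `N * ∏ j, (X - y j) = ∑ a, k a * ∏ b ≠ a, (X - x b)` holds at the nodes `x`, the product
over `i` of the second derivatives of `∏ a, (X - x a) ^ k a` at `y i` is expressed by the Cauchy
determinant of `x` and `y`. -/
theorem prod_critical_eq_cauchy {K : Type*} [Field K] {d : ℕ} (N : K)
    (k : Fin (d + 1) → ℕ) (hk : ∀ a, 0 < k a) (x : Fin (d + 1) → K) (y : Fin d → K)
    (hx : Function.Injective x) (hy : Function.Injective y) (hxy : ∀ a i, x a ≠ y i)
    (hcrit : ∀ a, N * ∏ j, (x a - y j) = k a * ∏ b ∈ {a}ᶜ, (x a - x b)) :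
    N ^ (∑ a, (k a - 1) + d) *
        ∏ i, (N * (∏ a, (y i - x a) ^ (k a - 1)) * ∏ j ∈ {i}ᶜ, (y i - y j)) =
      (-1) ^ (∑ a : Fin _, (a : ℕ) * k a + (∑ a, (k a - 1) + d) * d) *
        (∏ a : Fin d, (k a.succ : K) ^ 2) * (∏ a, (k a : K) ^ (k a - 1)) *
        (Matrix.of fun i a : Fin d => 1 / (x a.succ - y i)).det ^ 2 *
        ∏ a, ∏ b ∈ Finset.Ioi a, (x a - x b) ^ (k a + k b) := by
  set D : Fin (d + 1) → K := fun a => ∏ b ∈ {a}ᶜ, (x a - x b) with hD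
  set W := ∏ a, ∏ b ∈ Finset.Ioi a, (x a - x b) with hW
  set Wk := ∏ a, ∏ b ∈ Finset.Ioi a, (x a - x b) ^ (k a + k b)
  set Vy := ∏ a, ∏ b ∈ Finset.Ioi a, (y a - y b) with hVy
  set Vz := ∏ a : Fin d, ∏ b ∈ Finset.Ioi a, (x a.succ - x b.succ) with hVz
  set Δ := (Matrix.of fun i a : Fin d => 1 / (x a.succ - y i)).det
  set e := ∑ a, (k a - 1) with he
  set s := ∑ a : Fin d, (a : ℕ) with hs
  set S := ∑ a : Fin _, (a : ℕ) * k a with hS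
  have hW0 : W ≠ 0 := prod_prod_Ioi_sub_ne_zero hx
  have hVz0 : Vz ≠ 0 := prod_prod_Ioi_sub_ne_zero (hx.comp (Fin.succ_injective d))
  have hcompl : ({0}ᶜ : Finset (Fin (d + 1))) = Finset.Ioi 0 := by
    ext b; simp
  have hWD : W = D 0 * Vz := by
    simp only [hW, hD, hVz, hcompl]
    rw [Fin.prod_univ_succ]
    simp only [Fin.prod_Ioi_succ]
  have hD0 : D 0 ≠ 0 := fun h => hW0 (by rw [hWD, h, zero_mul])
  have hDprod : ∏ a, D a = (-1) ^ (s + d) * W ^ 2 := by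
    rw [hD, prod_prod_compl_sub, Fin.sum_univ_castSucc]
    simp [hs, hW]
  have hDk : ∏ a, D a ^ k a = (-1) ^ S * Wk := prod_pow_prod_compl_sub x k
  have hDsucc : (∏ a : Fin d, D a.succ) ^ 2 = W ^ 2 * Vz ^ 2 := by
    have h := congrArg (· ^ 2) hDprod
    simp only [Fin.prod_univ_succ, mul_pow, ← pow_mul, pow_mul' _ (s + d) 2, neg_one_sq,
      one_pow, one_mul] at h
    refine mul_left_cancel₀ (pow_ne_zero 2 hD0) (h.trans ?_)
    rw [hWD]; ring
  have hΔ : (∏ a : Fin d, (k a.succ : K) ^ 2) * W ^ 2 * Δ ^ 2 = N ^ (2 * d) * Vy ^ 2 := by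
    have h := sq_prod_mul_sq_det_cauchy y (fun a => x a.succ) hy fun a i => hxy _ i
    have h2 : N ^ (2 * d) * (∏ a : Fin d, ∏ j, (x a.succ - y j)) ^ 2 =
        (∏ a : Fin d, (k a.succ : K) ^ 2) * (W ^ 2 * Vz ^ 2) := by
      rw [← hDsucc, Finset.prod_pow, ← mul_pow, ← Finset.prod_mul_distrib]
      simp_rw [hD, ← hcrit, Finset.prod_mul_distrib]
      simp [mul_pow, ← pow_mul, mul_comm]
    refine mul_right_cancel₀ (pow_ne_zero 2 hVz0) ?_
    change _ * Δ ^ 2 = Vz ^ 2 * Vy ^ 2 at h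
    linear_combination (-Δ ^ 2) * h2 + N ^ (2 * d) * h
  have hR : N ^ e * (∏ i, ∏ a, (y i - x a) ^ (k a - 1)) * ∏ a, D a =
      (-1) ^ (d * e) * (∏ a, (k a : K) ^ (k a - 1)) * ∏ a, D a ^ k a := by
    rw [Finset.prod_comm, he, ← Finset.prod_pow_eq_pow_sum, mul_comm d, Finset.sum_mul,
      ← Finset.prod_pow_eq_pow_sum]
    simp_rw [← Finset.prod_mul_distrib]
    refine Finset.prod_congr rfl fun a _ => ?_
    have h1 : ∏ i, (y i - x a) = (-1) ^ d * ∏ j, (x a - y j) := by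
      simp_rw [← neg_sub (x a) (y _)]
      rw [Finset.prod_neg]; simp
    have h2 : D a ^ k a = D a ^ (k a - 1) * D a := by
      rw [← pow_succ, Nat.sub_add_cancel (hk a)]
    rw [Finset.prod_pow, h1, h2, mul_comm _ d, pow_mul, ← mul_assoc, ← mul_pow, ← mul_pow,
      ← mul_pow, mul_assoc, hD, ← hcrit]
    ring
  have hdd : (-1 : K) ^ (d * d) * (-1) ^ d = 1 := by
    rw [← pow_add, ← Nat.mul_succ]; exact (Nat.even_mul_succ_self d).neg_one_pow
  rw [Finset.prod_mul_distrib, Finset.prod_mul_distrib, prod_prod_compl_sub]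
  simp only [Finset.prod_const, Finset.card_univ, Fintype.card_fin]
  have hc : (-1 : K) ^ (s + d) * W ^ 2 ≠ 0 := by simp [hW0]
  refine mul_right_cancel₀ hc ?_
  rw [hDprod, hDk] at hR
  rw [pow_add (-1 : K) S, add_mul, pow_add (-1 : K) (e * d), mul_comm e d]
  rw [pow_add N, ← hs, ← hVy, pow_add]
  rw [pow_add (-1 : K) s] at hR
  set P := ∏ a, (k a : K) ^ (k a - 1)
  linear_combination (N ^ (2 * d) * (-1) ^ s * Vy ^ 2) * hR -
    ((-1) ^ S * (-1) ^ (d * e) * (-1) ^ (d * d) * P * Wk * ((-1) ^ s * (-1) ^ d)) * hΔ -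
    ((-1) ^ S * (-1) ^ (d * e) * (-1) ^ s * P * Wk * N ^ (2 * d) * Vy ^ 2) * hdd

theorem stmt5 (d : ℕ) (hd : 1 ≤ d) (m : ℕ → ℕ)
    (hm : ∀ i ∈ Finset.range (d + 1), 0 < m i)
    (n : ℕ) (hn : n + 1 = ∑ i ∈ Finset.range (d + 1), m i)
    (ξ : ℕ → ℂ)
    (hξ : ∀ i ∈ Finset.range (d + 1), ∀ j ∈ Finset.range (d + 1), i ≠ j → ξ i ≠ ξ j)
    (q : ℕ → ℂ)
    (hq : ∀ i ∈ Finset.Icc 1 d, ∀ j ∈ Finset.Icc 1 d, i ≠ j → q i ≠ q j)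
    (hξq : ∀ a ∈ Finset.range (d + 1), ∀ i ∈ Finset.Icc 1 d, ξ a ≠ q i)
    (hfact : (∏ i ∈ Finset.range (d + 1), (X - C (ξ i)) ^ m i).derivative =
      C ((n : ℂ) + 1) *
        (∏ i ∈ Finset.range (d + 1), (X - C (ξ i)) ^ (m i - 1)) *
        ∏ j ∈ Finset.Icc 1 d, (X - C (q j))) :
    ∏ i ∈ Finset.Icc 1 d,
        (derivative (derivative
          (∏ i ∈ Finset.range (d + 1), (X - C (ξ i)) ^ m i))).eval (q i) =
      ((-1 : ℂ) ^ (∑ i ∈ Finset.Icc 1 d, i * m i + n * d) *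
          ((n : ℂ) + 1) ^ (-(n : ℤ)) *
          (∏ a ∈ Finset.Icc 1 d, (m a : ℂ) ^ 2) *
          ∏ a ∈ Finset.range (d + 1), (m a : ℂ) ^ (m a - 1)) *
        (Matrix.of fun i a : Fin d => 1 / (ξ (a.1 + 1) - q (i.1 + 1))).det ^ 2 *
        ∏ i ∈ Finset.range (d + 1), ∏ j ∈ Finset.Ioo i (d + 1),
          (ξ i - ξ j) ^ (m i + m j) := by
  have hIcc {M : Type} [CommMonoid M] (f : ℕ → M) :
      ∏ i ∈ Finset.Icc 1 d, f i = ∏ i : Fin d, f (i + 1) := by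
    rw [← Finset.prod_range (fun i => f (i + 1)), Finset.range_eq_Ico,
      Finset.prod_Ico_add' f 0 d 1]
    rfl
  set x : Fin (d + 1) → ℂ := fun a => ξ a with hx_def
  set y : Fin d → ℂ := fun i => q (i + 1) with hy_def
  set k : Fin (d + 1) → ℕ := fun a => m a with hk_def
  have hk : ∀ a, 0 < k a := fun a => hm a (Finset.mem_range.2 a.2)
  have hx : Function.Injective x := fun a b h => by
    by_contra hab
    exact hξ a (Finset.mem_range.2 a.2) b (Finset.mem_range.2 b.2) (Fin.val_ne_of_ne hab) h
  have hmem (i : Fin d) : (i : ℕ) + 1 ∈ Finset.Icc 1 d := by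
    simp only [Finset.mem_Icc]; omega
  have hy : Function.Injective y := fun a b h => by
    by_contra hab
    exact hq _ (hmem a) _ (hmem b) (by simpa using Fin.val_ne_of_ne hab) h
  have hxy : ∀ a i, x a ≠ y i := fun a i => hξq a (Finset.mem_range.2 a.2) _ (hmem i)
  have hN : (n : ℂ) + 1 ≠ 0 := Nat.cast_add_one_ne_zero n
  simp only [Finset.prod_range, hIcc] at hfact ⊢
  change derivative (∏ a, (X - C (x a)) ^ k a) = C ((n : ℂ) + 1) *
    (∏ a, (X - C (x a)) ^ (k a - 1)) * ∏ j, (X - C (y j)) at hfact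
  have hder : derivative (∏ a, (X - C (x a)) ^ k a) =
      (∏ a, (X - C (x a)) ^ (k a - 1)) *
        ∑ a, C (k a : ℂ) * ∏ b ∈ {a}ᶜ, (X - C (x b)) := by
    rw [derivative_prod_finset, Finset.mul_sum]
    refine Finset.sum_congr rfl fun a _ => ?_
    have h1 : ∏ b ∈ {a}ᶜ, (X - C (x b)) ^ k b =
        (∏ b ∈ {a}ᶜ, (X - C (x b)) ^ (k b - 1)) * ∏ b ∈ {a}ᶜ, (X - C (x b)) := by
      rw [← Finset.prod_mul_distrib]
      exact Finset.prod_congr rfl fun b _ => by rw [← pow_succ, Nat.sub_add_cancel (hk b)]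
    rw [← Finset.compl_singleton, h1, derivative_X_sub_C_pow,
      ← Finset.prod_compl_mul_prod {a} fun b => (X - C (x b)) ^ (k b - 1),
      Finset.prod_singleton]
    simp only [map_natCast]
    ring
  have hcrit : ∀ a, ((n : ℂ) + 1) * ∏ j, (x a - y j) = k a * ∏ b ∈ {a}ᶜ, (x a - x b) := by
    intro a
    have hR : ∏ a, (X - C (x a)) ^ (k a - 1) ≠ 0 :=
      Finset.prod_ne_zero_iff.2 fun b _ => pow_ne_zero _ (X_sub_C_ne_zero _)
    have h : C ((n : ℂ) + 1) * ∏ j, (X - C (y j)) =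
        ∑ a, C (k a : ℂ) * ∏ b ∈ {a}ᶜ, (X - C (x b)) := by
      refine mul_left_cancel₀ hR ?_
      rw [← hder, hfact]; ring
    have h2 := congrArg (eval (x a)) h
    rw [eval_finsetSum, Finset.sum_eq_single a] at h2
    · simpa [eval_prod] using h2
    · intro b _ hb
      rw [eval_mul, eval_prod, Finset.prod_eq_zero (i := a) (by simpa using hb.symm) (by simp),
        mul_zero]
    · simp
  have hsecond : ∀ i, eval (y i) (derivative (derivative (∏ a, (X - C (x a)) ^ k a))) =
      ((n : ℂ) + 1) * (∏ a, (y i - x a) ^ (k a - 1)) * ∏ j ∈ {i}ᶜ, (y i - y j) := by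
    intro i
    rw [hfact, ← Finset.prod_compl_mul_prod {i} fun j => X - C (y j), Finset.prod_singleton,
      ← mul_assoc, derivative_mul]
    simp [eval_prod]
  have hn' : n = ∑ a, (k a - 1) + d := by
    have h : ∑ a, k a = ∑ a, (k a - 1) + (d + 1) := by
      conv_lhs => rw [← Finset.sum_congr rfl fun a _ => Nat.sub_add_cancel (hk a)]
      simp [Finset.sum_add_distrib]
    rw [Finset.sum_range] at hn
    change n + 1 = ∑ a, k a at hn
    omega
  have hS : ∑ i ∈ Finset.Icc 1 d, i * m i = ∑ a : Fin _, (a : ℕ) * k a := by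
    have h := hIcc (M := Multiplicative ℕ) fun i => Multiplicative.ofAdd (i * m i)
    rw [← ofAdd_sum, ← ofAdd_sum] at h
    rw [Multiplicative.ofAdd.injective h, Fin.sum_univ_succ]
    simp [hk_def]
  have hIoo : ∏ i : Fin (d + 1), ∏ j ∈ Finset.Ioo (i : ℕ) (d + 1), (ξ i - ξ j) ^ (m i + m j) =
      ∏ a, ∏ b ∈ Finset.Ioi a, (x a - x b) ^ (k a + k b) := by
    refine Finset.prod_congr rfl fun a _ => ?_
    have : Finset.Ioo (a : ℕ) (d + 1) = (Finset.Ioi a).map Fin.valEmbedding := by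
      simp
    rw [this, Finset.prod_map]
    rfl
  have hmain := prod_critical_eq_cauchy ((n : ℂ) + 1) k hk x y hx hy hxy hcrit
  rw [← hn'] at hmain
  rw [hIoo, hS]
  change ∏ i, eval (y i) (derivative (derivative (∏ a, (X - C (x a)) ^ k a))) = _
  simp_rw [hsecond]
  refine mul_left_cancel₀ (pow_ne_zero n hN) (hmain.trans ?_)
  have hcancel : ((n : ℂ) + 1) ^ n * ((n : ℂ) + 1) ^ (-(n : ℤ)) = 1 := by
    rw [zpow_neg, zpow_natCast, mul_inv_cancel₀ (pow_ne_zero n hN)]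
  simp only [hx_def, hy_def, hk_def, Fin.val_succ]
  simp only [← mul_assoc]
  rw [mul_right_comm _ _ (((n : ℂ) + 1) ^ (-(n : ℤ))), hcancel, one_mul]
end

section
/- Let d ≥ 1, let m be an integer, let m₁,…,m_d be positive integers with N := m + m₁ + ⋯ + m_d ≠ 0, and let ξ₁,…,ξ_d ∈ ℂ. Let μ(X) := ∏_{i=1}^d (X² − ξᵢ²)^{mᵢ} ∈ ℂ[X]. Then there exist q₁,…,q_d ∈ ℂ such that 2m·μ(X) + X·μ′(X) = 2N·∏_{i=1}^d (X² − ξᵢ²)^{mᵢ−1}·∏_{i=1}^d (X² − qᵢ²). -/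
open Polynomial

/-- The Euler-type derivative `2c μ + X μ'` of `μ = ∏ (X² - aᵢ)^(kᵢ)` is `∏ (X² - aᵢ)^(kᵢ - 1)` times
an even polynomial, whose degree in `X²` and top coefficient are controlled. -/
theorem exists_comp_sq_eq_euler_derivative {R ι : Type*} [CommRing R] (c : R) (a : ι → R)
    (k : ι → ℕ) (s : Finset ι) (hk : ∀ i ∈ s, 0 < k i) :
    ∃ p : R[X], p.natDegree ≤ s.card ∧ p.coeff s.card = 2 * (c + ∑ i ∈ s, (k i : R)) ∧
      C (2 * c) * (∏ i ∈ s, (X ^ 2 - C (a i)) ^ k i) +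
          X * (∏ i ∈ s, (X ^ 2 - C (a i)) ^ k i).derivative =
        (∏ i ∈ s, (X ^ 2 - C (a i)) ^ (k i - 1)) * p.comp (X ^ 2) := by
  classical
  nontriviality R
  induction s using Finset.induction_on with
  | empty => exact ⟨C (2 * c), (natDegree_C _).le, by simp, by simp⟩
  | insert j s hj ih =>
    obtain ⟨p, hdeg, hcoeff, hp⟩ := ih fun i hi => hk i (Finset.mem_insert_of_mem hi)
    have hmonic : (∏ i ∈ s, (X - C (a i))).Monic := monic_prod_of_monic _ _ fun i _ => monic_X_sub_C _
    have hnat : (∏ i ∈ s, (X - C (a i))).natDegree = s.card := by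
      simp [natDegree_prod_of_monic _ _ fun i _ => monic_X_sub_C (a i)]
    have htop : (∏ i ∈ s, (X - C (a i))).coeff s.card = 1 := by
      rw [← hnat]; exact hmonic
    refine ⟨(X - C (a j)) * p + C (2 * (k j : R)) * (X * ∏ i ∈ s, (X - C (a i))), ?_, ?_, ?_⟩
    · rw [Finset.card_insert_of_notMem hj]
      refine natDegree_add_le_of_degree_le ?_ ?_
      · refine natDegree_mul_le.trans ?_
        rw [natDegree_X_sub_C]
        omega
      · refine (natDegree_C_mul_le _ _).trans (natDegree_mul_le.trans ?_)
        rw [natDegree_X, hnat, add_comm]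
    · have hzero : p.coeff (s.card + 1) = 0 := coeff_eq_zero_of_natDegree_lt (by omega)
      rw [Finset.card_insert_of_notMem hj, Finset.sum_insert hj, coeff_add, sub_mul, coeff_sub,
        coeff_X_mul, coeff_C_mul, coeff_C_mul, coeff_X_mul, hcoeff, hzero, htop]
      ring
    · obtain ⟨n, hn⟩ := Nat.exists_eq_add_of_lt (hk j (Finset.mem_insert_self j s))
      have hprod : ∏ i ∈ s, (X ^ 2 - C (a i)) ^ k i =
          (∏ i ∈ s, (X ^ 2 - C (a i)) ^ (k i - 1)) * ∏ i ∈ s, (X ^ 2 - C (a i)) := by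
        rw [← Finset.prod_mul_distrib]
        refine Finset.prod_congr rfl fun i hi => ?_
        rw [← pow_succ, Nat.sub_add_cancel (hk i (Finset.mem_insert_of_mem hi))]
      have hkj : k j = n + 1 := by omega
      have hcomp : (∏ i ∈ s, (X - C (a i))).comp (X ^ 2) = ∏ i ∈ s, (X ^ 2 - C (a i)) := by
        simp [prod_comp]
      rw [Finset.prod_insert hj, Finset.prod_insert hj, derivative_mul, derivative_pow]
      simp only [hkj, add_comp, mul_comp, hcomp, sub_comp, X_comp, C_comp, derivative_sub,
        derivative_X_sq, derivative_C, Nat.add_sub_cancel, map_mul] at hp ⊢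
      have h2 : (C 2 : R[X]) = 2 := rfl
      rw [h2] at hp ⊢
      linear_combination (X ^ 2 - C (a j)) ^ (n + 1) * hp +
        2 * C ((n + 1 : ℕ) : R) * X ^ 2 * (X ^ 2 - C (a j)) ^ n * hprod

theorem Multiset.exists_prod_map_eq_prod_Icc {α M : Type*} [Inhabited α] [CommMonoid M]
    (f : α → M) (s : Multiset α) :
    ∃ r : ℕ → α, (s.map f).prod = ∏ i ∈ Finset.Icc 1 s.card, f (r i) := by
  induction s using Multiset.induction_on with
  | empty => exact ⟨fun _ => default, by simp⟩
  | cons a s ih =>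
    obtain ⟨r, hr⟩ := ih
    refine ⟨Function.update r (s.card + 1) a, ?_⟩
    rw [Multiset.map_cons, Multiset.prod_cons, Multiset.card_cons,
      Finset.prod_Icc_succ_top (Nat.le_add_left 1 _), hr, Function.update_self, mul_comm]
    congr 1
    refine Finset.prod_congr rfl fun i hi => ?_
    rw [Function.update_of_ne]
    have := (Finset.mem_Icc.mp hi).2
    omega

theorem stmt6 (d : ℕ) (hd : 1 ≤ d) (m : ℤ) (mm : ℕ → ℕ)
    (hmm : ∀ i ∈ Finset.Icc 1 d, 0 < mm i)
    (N : ℤ) (hN : N = m + ∑ i ∈ Finset.Icc 1 d, (mm i : ℤ)) (hN0 : N ≠ 0)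
    (ξ : ℕ → ℂ) :
    ∃ q : ℕ → ℂ,
      C (2 * (m : ℂ)) * (∏ i ∈ Finset.Icc 1 d, (X ^ 2 - C (ξ i ^ 2)) ^ mm i) +
          X * (∏ i ∈ Finset.Icc 1 d, (X ^ 2 - C (ξ i ^ 2)) ^ mm i).derivative =
        C (2 * (N : ℂ)) *
          (∏ i ∈ Finset.Icc 1 d, (X ^ 2 - C (ξ i ^ 2)) ^ (mm i - 1)) *
          ∏ i ∈ Finset.Icc 1 d, (X ^ 2 - C (q i ^ 2)) := by
  obtain ⟨p, hdeg, hcoeff, hp⟩ :=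
    exists_comp_sq_eq_euler_derivative (m : ℂ) (fun i => ξ i ^ 2) mm (Finset.Icc 1 d) hmm
  rw [Nat.card_Icc, Nat.add_sub_cancel] at hdeg hcoeff
  have hNC : (m : ℂ) + ∑ i ∈ Finset.Icc 1 d, (mm i : ℂ) = N := by
    rw [hN]; push_cast; rfl
  rw [hNC] at hcoeff
  have hnat : p.natDegree = d := by
    refine natDegree_eq_of_le_of_coeff_ne_zero hdeg ?_
    rw [hcoeff]
    exact mul_ne_zero two_ne_zero (Int.cast_ne_zero.mpr hN0)
  have hlead : p.leadingCoeff = 2 * N := by rw [leadingCoeff, hnat, hcoeff]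
  have hsplits : p.Splits := IsAlgClosed.splits p
  obtain ⟨r, hr⟩ := Multiset.exists_prod_map_eq_prod_Icc (fun z : ℂ => X - C z) p.roots
  rw [← hsplits.natDegree_eq_card_roots, hnat] at hr
  choose q hq using fun i => IsAlgClosed.exists_pow_nat_eq (r i) two_pos
  refine ⟨q, hp.trans ?_⟩
  rw [hsplits.eq_prod_roots, hr, hlead]
  simp only [mul_comp, C_comp, prod_comp, sub_comp, X_comp, hq]
  ring
end

section
/- Let d ≥ 1, m an integer, m₁,…,m_d positive integers, N := m + m₁ + ⋯ + m_d, and let ξ₁,…,ξ_d ∈ ℂ have pairwise distinct squares (ξ_a² ≠ ξ_b² for a ≠ b). Let μ(X) := ∏_{i=1}^d (X² − ξᵢ²)^{mᵢ} and suppose q₁,…,q_d ∈ ℂ satisfy 2m·μ(X) + X·μ′(X) = 2N·∏_{i=1}^d (X² − ξᵢ²)^{mᵢ−1}·∏_{i=1}^d (X² − qᵢ²). Then for every a ∈ {1,…,d}: N·∏_{i=1}^d (ξ_a² − qᵢ²) = m_a·ξ_a²·∏_{b≠a} (ξ_a² − ξ_b²). -/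
open Polynomial

theorem prod_pow_eq_prod_pow_pred_mul {ι R : Type*} [CommMonoid R] (s : Finset ι) (n : ι → ℕ)
    (hn : ∀ i ∈ s, 0 < n i) (f : ι → R) :
    ∏ i ∈ s, f i ^ n i = (∏ i ∈ s, f i ^ (n i - 1)) * ∏ i ∈ s, f i := by
  rw [← Finset.prod_mul_distrib]
  exact Finset.prod_congr rfl fun i hi => (pow_sub_one_mul (hn i hi).ne' (f i)).symm

theorem derivative_prod_pow {ι R : Type*} [DecidableEq ι] [CommRing R] (s : Finset ι) (n : ι → ℕ)
    (hn : ∀ i ∈ s, 0 < n i) (f : ι → R[X]) :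
    (∏ i ∈ s, f i ^ n i).derivative =
      (∏ i ∈ s, f i ^ (n i - 1)) *
        ∑ i ∈ s, C (n i : R) * (f i).derivative * ∏ j ∈ s.erase i, f j := by
  rw [derivative_prod_finset, Finset.mul_sum]
  refine Finset.sum_congr rfl fun i hi => ?_
  rw [prod_pow_eq_prod_pow_pred_mul (s.erase i) n (fun j hj => hn j (Finset.mem_of_mem_erase hj)) f,
    ← Finset.mul_prod_erase s (fun j => f j ^ (n j - 1)) hi, derivative_pow]
  ring

theorem stmt7 (d : ℕ) (hd : 1 ≤ d) (m : ℤ) (mm : ℕ → ℕ)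
    (hmm : ∀ i ∈ Finset.Icc 1 d, 0 < mm i)
    (N : ℤ) (hN : N = m + ∑ i ∈ Finset.Icc 1 d, (mm i : ℤ))
    (ξ : ℕ → ℂ)
    (hξ : ∀ a ∈ Finset.Icc 1 d, ∀ b ∈ Finset.Icc 1 d, a ≠ b → ξ a ^ 2 ≠ ξ b ^ 2)
    (q : ℕ → ℂ)
    (hfact : C (2 * (m : ℂ)) * (∏ i ∈ Finset.Icc 1 d, (X ^ 2 - C (ξ i ^ 2)) ^ mm i) +
        X * (∏ i ∈ Finset.Icc 1 d, (X ^ 2 - C (ξ i ^ 2)) ^ mm i).derivative =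
      C (2 * (N : ℂ)) *
        (∏ i ∈ Finset.Icc 1 d, (X ^ 2 - C (ξ i ^ 2)) ^ (mm i - 1)) *
        ∏ i ∈ Finset.Icc 1 d, (X ^ 2 - C (q i ^ 2))) :
    ∀ a ∈ Finset.Icc 1 d,
      (N : ℂ) * ∏ i ∈ Finset.Icc 1 d, (ξ a ^ 2 - q i ^ 2) =
        (mm a : ℂ) * ξ a ^ 2 * ∏ b ∈ (Finset.Icc 1 d).erase a, (ξ a ^ 2 - ξ b ^ 2) := by
  intro a ha
  have hP : ∏ i ∈ Finset.Icc 1 d, (X ^ 2 - C (ξ i ^ 2)) ^ (mm i - 1) ≠ 0 :=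
    Finset.prod_ne_zero_iff.mpr fun i _ =>
      pow_ne_zero _ (X_pow_sub_C_ne_zero two_pos (ξ i ^ 2))
  rw [derivative_prod_pow _ _ hmm, prod_pow_eq_prod_pow_pred_mul _ _ hmm] at hfact
  have key : C (2 * (m : ℂ)) * (∏ i ∈ Finset.Icc 1 d, (X ^ 2 - C (ξ i ^ 2))) +
      X * ∑ i ∈ Finset.Icc 1 d, C (mm i : ℂ) * (X ^ 2 - C (ξ i ^ 2)).derivative *
        ∏ j ∈ (Finset.Icc 1 d).erase i, (X ^ 2 - C (ξ j ^ 2)) =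
      C (2 * (N : ℂ)) * ∏ i ∈ Finset.Icc 1 d, (X ^ 2 - C (q i ^ 2)) :=
    mul_left_cancel₀ hP (by linear_combination hfact)
  have hev := congrArg (eval (ξ a)) key
  simp only [eval_add, eval_mul, eval_prod, eval_finsetSum, eval_sub, eval_pow, eval_X, eval_C,
    derivative_sub, derivative_X_sq, derivative_C, sub_zero] at hev
  rw [Finset.prod_eq_zero ha (sub_self (ξ a ^ 2)), Finset.sum_eq_single_of_mem a ha
    fun i _ hia => by
      rw [Finset.prod_eq_zero (Finset.mem_erase.mpr ⟨hia.symm, ha⟩) (sub_self (ξ a ^ 2)),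
        mul_zero]] at hev
  linear_combination -hev / 2
end

section
/- Let d ≥ 1, m a nonzero integer, m₁,…,m_d positive integers, N := m + m₁ + ⋯ + m_d ≠ 0, and let ξ₁,…,ξ_d ∈ ℂ be nonzero with pairwise distinct squares. Let μ(X) := ∏_{i=1}^d (X² − ξᵢ²)^{mᵢ} and suppose q₁,…,q_d ∈ ℂ are all nonzero and satisfy 2m·μ(X) + X·μ′(X) = 2N·∏_{i=1}^d (X² − ξᵢ²)^{mᵢ−1}·∏_{i=1}^d (X² − qᵢ²). For i ∈ {1,…,d} set Pᵢ := 4N·qᵢ^{2m}·∏_{a=1}^d (qᵢ² − ξ_a²)^{m_a−1}·∏_{b≠i} (qᵢ² − q_b²) (the value λ″(qᵢ) of the second derivative of λ = X^{2m}μ). Then ∏_{i=1}^d Pᵢ = c · ∏_{1≤i<j≤d} (qᵢ² − q_j²)² · ∏_{a=1}^d ξ_a^{2(m+m_a−1)} · ∏_{a≠b} (ξ_a² − ξ_b²)^{m_a−1}, where c = (−1)^{d·(∑_{a=1}^d m_a) + d(d+1)/2}·4^d·N^{2d−N}·(∏_{a=1}^d m_a^{m_a−1})·m^m (integer powers of the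 nonzero complex numbers N, m, ξ_a, qᵢ are taken in the sense of ℤ-powers). -/
open Polynomial

/-- The product of all differences `y i - y b` over ordered pairs, up to sign a product of
squares over unordered pairs. -/
theorem prod_prod_erase_sub_eq {R : Type*} [CommRing R] (y : ℕ → R) (d : ℕ) :
    ∏ i ∈ Finset.Icc 1 d, ∏ b ∈ (Finset.Icc 1 d).erase i, (y i - y b) =
      (-1) ^ (d + d * (d + 1) / 2) *
        ∏ i ∈ Finset.Icc 1 d, ∏ j ∈ Finset.Ioc i d, (y i - y j) ^ 2 := by
  induction d with
  | zero => simp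
  | succ d ih =>
    have hnot : d + 1 ∉ Finset.Icc 1 d := by simp
    have hIcc : Finset.Icc 1 (d + 1) = insert (d + 1) (Finset.Icc 1 d) := by
      ext x
      simp only [Finset.mem_Icc, Finset.mem_insert]
      omega
    have herase : ∀ i ∈ Finset.Icc 1 d,
        ∏ b ∈ (Finset.Icc 1 (d + 1)).erase i, (y i - y b) =
          (y i - y (d + 1)) * ∏ b ∈ (Finset.Icc 1 d).erase i, (y i - y b) := by
      intro i hi
      have hne : d + 1 ≠ i := by
        rintro rfl
        exact hnot hi
      rw [hIcc, Finset.erase_insert_of_ne hne, Finset.prod_insert (by simp)]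
    have hIoc : ∀ i ∈ Finset.Icc 1 d, ∏ j ∈ Finset.Ioc i (d + 1), (y i - y j) ^ 2 =
        (y i - y (d + 1)) ^ 2 * ∏ j ∈ Finset.Ioc i d, (y i - y j) ^ 2 := by
      intro i hi
      have hins : Finset.Ioc i (d + 1) = insert (d + 1) (Finset.Ioc i d) := by
        ext x
        simp only [Finset.mem_Ioc, Finset.mem_insert, Finset.mem_Icc] at hi ⊢
        omega
      rw [hins, Finset.prod_insert (by simp)]
    have hsign : ∏ b ∈ Finset.Icc 1 d, (y (d + 1) - y b) =
        (-1) ^ d * ∏ b ∈ Finset.Icc 1 d, (y b - y (d + 1)) := by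
      simp_rw [← neg_sub (y _) (y (d + 1)), Finset.prod_neg, Nat.card_Icc, Nat.add_sub_cancel]
    have hexp : (d + 1) * (d + 1 + 1) / 2 = d * (d + 1) / 2 + (d + 1) := by
      rw [show (d + 1) * (d + 1 + 1) = d * (d + 1) + (d + 1) * 2 by ring,
        Nat.add_mul_div_right _ _ two_pos]
    have hpow : (-1 : R) ^ (d + 1 + (d + 1) * (d + 1 + 1) / 2) =
        (-1) ^ d * (-1) ^ (d + d * (d + 1) / 2) := by
      rw [hexp, show d + 1 + (d * (d + 1) / 2 + (d + 1)) = d + (d + d * (d + 1) / 2) + 2 * 1 by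
        ring, pow_add, pow_mul, neg_one_sq, one_pow, mul_one, pow_add]
    have hlhs : ∏ i ∈ Finset.Icc 1 (d + 1),
        ∏ b ∈ (Finset.Icc 1 (d + 1)).erase i, (y i - y b) =
        (∏ b ∈ Finset.Icc 1 d, (y (d + 1) - y b)) *
          ∏ i ∈ Finset.Icc 1 d, ((y i - y (d + 1)) *
            ∏ b ∈ (Finset.Icc 1 d).erase i, (y i - y b)) := by
      rw [← Finset.prod_congr rfl herase, hIcc, Finset.prod_insert hnot,
        Finset.erase_insert hnot]
    have hrhs : ∏ i ∈ Finset.Icc 1 (d + 1), ∏ j ∈ Finset.Ioc i (d + 1), (y i - y j) ^ 2 =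
        ∏ i ∈ Finset.Icc 1 d,
          ((y i - y (d + 1)) ^ 2 * ∏ j ∈ Finset.Ioc i d, (y i - y j) ^ 2) := by
      rw [← Finset.prod_congr rfl hIoc, hIcc, Finset.prod_insert hnot]
      simp
    rw [hlhs, hrhs, hpow, Finset.prod_mul_distrib, Finset.prod_mul_distrib, ih, hsign,
      Finset.prod_pow]
    ring

/-- `X` times the derivative of `∏ (X ^ 2 - x i) ^ n i`, with the common factor extracted. -/
theorem X_mul_derivative_prod_X_sq_sub_C_pow {ι R : Type*} [DecidableEq ι] [CommRing R]
    (s : Finset ι) (n : ι → ℕ) (hn : ∀ i ∈ s, 0 < n i) (x : ι → R) :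
    X * (∏ i ∈ s, (X ^ 2 - C (x i)) ^ n i).derivative =
      (∏ i ∈ s, (X ^ 2 - C (x i)) ^ (n i - 1)) *
        ∑ i ∈ s, C (2 * (n i : R)) * X ^ 2 * ∏ b ∈ s.erase i, (X ^ 2 - C (x b)) := by
  rw [derivative_prod_finset, Finset.mul_sum, Finset.mul_sum]
  refine Finset.sum_congr rfl fun i hi => ?_
  have hsplit : ∏ b ∈ s.erase i, (X ^ 2 - C (x b)) ^ n b =
      (∏ b ∈ s.erase i, (X ^ 2 - C (x b)) ^ (n b - 1)) *
        ∏ b ∈ s.erase i, (X ^ 2 - C (x b)) := by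
    rw [← Finset.prod_mul_distrib]
    refine Finset.prod_congr rfl fun b hb => ?_
    rw [← pow_succ, Nat.sub_add_cancel (hn b (Finset.mem_of_mem_erase hb))]
  rw [hsplit, ← Finset.mul_prod_erase s (fun b => (X ^ 2 - C (x b)) ^ (n b - 1)) hi,
    derivative_pow]
  simp only [derivative_sub, derivative_X_pow, derivative_C, sub_zero, C_mul, map_natCast,
    Nat.cast_ofNat, Nat.reduceSub, pow_one, map_ofNat]
  ring

/-- The reduced form of the factorization of twice m times μ plus X times the derivative of μ,
after cancelling the factor
`∏ (X ^ 2 - x i) ^ (n i - 1)`. -/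
theorem reduced_factorization {ι K : Type*} [DecidableEq ι] [Field K]
    (s : Finset ι) (n : ι → ℕ) (hn : ∀ i ∈ s, 0 < n i) (x y : ι → K) (m N : K)
    (h : C (2 * m) * (∏ i ∈ s, (X ^ 2 - C (x i)) ^ n i) +
        X * (∏ i ∈ s, (X ^ 2 - C (x i)) ^ n i).derivative =
      C (2 * N) * (∏ i ∈ s, (X ^ 2 - C (x i)) ^ (n i - 1)) * ∏ i ∈ s, (X ^ 2 - C (y i))) :
    C (2 * m) * (∏ i ∈ s, (X ^ 2 - C (x i))) +
        ∑ i ∈ s, C (2 * (n i : K)) * X ^ 2 * ∏ b ∈ s.erase i, (X ^ 2 - C (x b)) =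
      C (2 * N) * ∏ i ∈ s, (X ^ 2 - C (y i)) := by
  have hne : ∏ i ∈ s, (X ^ 2 - C (x i)) ^ (n i - 1) ≠ 0 :=
    Finset.prod_ne_zero_iff.2 fun i _ => pow_ne_zero _ (X_pow_sub_C_ne_zero two_pos _)
  have hsplit : ∏ i ∈ s, (X ^ 2 - C (x i)) ^ n i =
      (∏ i ∈ s, (X ^ 2 - C (x i)) ^ (n i - 1)) * ∏ i ∈ s, (X ^ 2 - C (x i)) := by
    rw [← Finset.prod_mul_distrib]
    refine Finset.prod_congr rfl fun b hb => ?_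
    rw [← pow_succ, Nat.sub_add_cancel (hn b hb)]
  rw [X_mul_derivative_prod_X_sq_sub_C_pow s n hn x, hsplit] at h
  refine mul_left_cancel₀ hne ?_
  linear_combination h

/-- The reduced factorization at a zero of `μ`. -/
theorem residue_identity {ι K : Type*} [DecidableEq ι] [Field K] [CharZero K]
    (s : Finset ι) (n : ι → ℕ) (ξ y : ι → K) (m N : K)
    (h : C (2 * m) * (∏ i ∈ s, (X ^ 2 - C (ξ i ^ 2))) +
        ∑ i ∈ s, C (2 * (n i : K)) * X ^ 2 * ∏ b ∈ s.erase i, (X ^ 2 - C (ξ b ^ 2)) =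
      C (2 * N) * ∏ i ∈ s, (X ^ 2 - C (y i))) {a : ι} (ha : a ∈ s) :
    n a * ξ a ^ 2 * ∏ b ∈ s.erase a, (ξ a ^ 2 - ξ b ^ 2) =
      N * ∏ i ∈ s, (ξ a ^ 2 - y i) := by
  have he := congrArg (eval (ξ a)) h
  simp only [eval_add, eval_mul, eval_C, eval_finsetSum, eval_prod, eval_sub, eval_pow,
    eval_X] at he
  rw [Finset.prod_eq_zero ha (sub_self _), Finset.sum_eq_single_of_mem a ha] at he
  · refine mul_left_cancel₀ (two_ne_zero (α := K)) ?_
    linear_combination he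
  · intro b _ hba
    rw [Finset.prod_eq_zero (Finset.mem_erase.2 ⟨hba.symm, ha⟩) (sub_self _), mul_zero]

/-- The reduced factorization at the origin. -/
theorem constant_term_identity {ι K : Type*} [DecidableEq ι] [Field K] [CharZero K]
    (s : Finset ι) (n : ι → ℕ) (x y : ι → K) (m N : K)
    (h : C (2 * m) * (∏ i ∈ s, (X ^ 2 - C (x i))) +
        ∑ i ∈ s, C (2 * (n i : K)) * X ^ 2 * ∏ b ∈ s.erase i, (X ^ 2 - C (x b)) =
      C (2 * N) * ∏ i ∈ s, (X ^ 2 - C (y i))) :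
    m * ∏ i ∈ s, x i = N * ∏ i ∈ s, y i := by
  have he := congrArg (eval 0) h
  simp only [eval_add, eval_mul, eval_C, eval_finsetSum, eval_prod, eval_sub, eval_pow,
    eval_X, ne_eq, OfNat.ofNat_ne_zero, not_false_eq_true, zero_pow, mul_zero, zero_mul,
    Finset.sum_const_zero, add_zero, zero_sub, Finset.prod_neg] at he
  refine mul_left_cancel₀ (mul_ne_zero (two_ne_zero (α := K))
    (pow_ne_zero s.card (neg_ne_zero.2 one_ne_zero))) ?_
  linear_combination he

theorem stmt9 (d : ℕ) (hd : 1 ≤ d) (m : ℤ) (hm0 : m ≠ 0) (mm : ℕ → ℕ)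
    (hmm : ∀ i ∈ Finset.Icc 1 d, 0 < mm i)
    (N : ℤ) (hN : N = m + ∑ i ∈ Finset.Icc 1 d, (mm i : ℤ)) (hN0 : N ≠ 0)
    (ξ : ℕ → ℂ) (hξ0 : ∀ a ∈ Finset.Icc 1 d, ξ a ≠ 0)
    (hξ : ∀ a ∈ Finset.Icc 1 d, ∀ b ∈ Finset.Icc 1 d, a ≠ b → ξ a ^ 2 ≠ ξ b ^ 2)
    (q : ℕ → ℂ) (hq0 : ∀ i ∈ Finset.Icc 1 d, q i ≠ 0)
    (hfact : C (2 * (m : ℂ)) * (∏ i ∈ Finset.Icc 1 d, (X ^ 2 - C (ξ i ^ 2)) ^ mm i) +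
        X * (∏ i ∈ Finset.Icc 1 d, (X ^ 2 - C (ξ i ^ 2)) ^ mm i).derivative =
      C (2 * (N : ℂ)) *
        (∏ i ∈ Finset.Icc 1 d, (X ^ 2 - C (ξ i ^ 2)) ^ (mm i - 1)) *
        ∏ i ∈ Finset.Icc 1 d, (X ^ 2 - C (q i ^ 2))) :
    ∏ i ∈ Finset.Icc 1 d,
        (4 * (N : ℂ) * q i ^ (2 * m) *
          (∏ a ∈ Finset.Icc 1 d, (q i ^ 2 - ξ a ^ 2) ^ (mm a - 1)) *
          ∏ b ∈ (Finset.Icc 1 d).erase i, (q i ^ 2 - q b ^ 2)) =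
      ((-1 : ℂ) ^ (d * (∑ a ∈ Finset.Icc 1 d, mm a) + d * (d + 1) / 2) *
          4 ^ d * (N : ℂ) ^ (2 * (d : ℤ) - N) *
          (∏ a ∈ Finset.Icc 1 d, (mm a : ℂ) ^ (mm a - 1)) * (m : ℂ) ^ m) *
        (∏ i ∈ Finset.Icc 1 d, ∏ j ∈ Finset.Ioc i d, (q i ^ 2 - q j ^ 2) ^ 2) *
        (∏ a ∈ Finset.Icc 1 d, ξ a ^ (2 * (m + (mm a : ℤ) - 1))) *
        ∏ a ∈ Finset.Icc 1 d, ∏ b ∈ (Finset.Icc 1 d).erase a,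
          (ξ a ^ 2 - ξ b ^ 2) ^ (mm a - 1) := by
  have hred := reduced_factorization (Finset.Icc 1 d) mm hmm (fun i => ξ i ^ 2)
    (fun i => q i ^ 2) (m : ℂ) (N : ℂ) hfact
  have hzero := constant_term_identity _ _ _ _ _ _ hred
  have hNC : (N : ℂ) ≠ 0 := Int.cast_ne_zero.2 hN0
  have hres : ∀ a ∈ Finset.Icc 1 d, ∏ i ∈ Finset.Icc 1 d, (q i ^ 2 - ξ a ^ 2) =
      (-1) ^ d * (N : ℂ)⁻¹ * mm a * ξ a ^ 2 *
        ∏ b ∈ (Finset.Icc 1 d).erase a, (ξ a ^ 2 - ξ b ^ 2) := by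
    intro a ha
    have h := residue_identity _ _ _ _ _ _ hred ha
    simp_rw [← neg_sub (ξ a ^ 2), Finset.prod_neg, Nat.card_Icc, Nat.add_sub_cancel]
    field_simp
    linear_combination -h
  have hq : ∏ i ∈ Finset.Icc 1 d, q i ^ (2 * m) =
      (m : ℂ) ^ m * (N : ℂ) ^ (-m) * ∏ a ∈ Finset.Icc 1 d, ξ a ^ (2 * m) := by
    have hprod : ∏ i ∈ Finset.Icc 1 d, q i ^ 2 =
        m * (N : ℂ)⁻¹ * ∏ a ∈ Finset.Icc 1 d, ξ a ^ 2 := by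
      field_simp
      linear_combination -hzero
    have hpow := congrArg (· ^ m) hprod
    simp only [mul_zpow, ← Finset.prod_zpow, inv_zpow, ← zpow_neg] at hpow
    simpa only [zpow_mul, zpow_ofNat] using hpow
  have hmix : ∏ i ∈ Finset.Icc 1 d, ∏ a ∈ Finset.Icc 1 d, (q i ^ 2 - ξ a ^ 2) ^ (mm a - 1) =
      (-1) ^ (d * ∑ a ∈ Finset.Icc 1 d, (mm a - 1)) *
        (N : ℂ)⁻¹ ^ (∑ a ∈ Finset.Icc 1 d, (mm a - 1)) *
        (∏ a ∈ Finset.Icc 1 d, (mm a : ℂ) ^ (mm a - 1)) *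
        (∏ a ∈ Finset.Icc 1 d, (ξ a ^ 2) ^ (mm a - 1)) *
        ∏ a ∈ Finset.Icc 1 d, ∏ b ∈ (Finset.Icc 1 d).erase a,
          (ξ a ^ 2 - ξ b ^ 2) ^ (mm a - 1) := by
    rw [Finset.prod_comm, pow_mul, ← Finset.prod_pow_eq_pow_sum, ← Finset.prod_pow_eq_pow_sum,
      ← Finset.prod_mul_distrib, ← Finset.prod_mul_distrib, ← Finset.prod_mul_distrib,
      ← Finset.prod_mul_distrib]
    refine Finset.prod_congr rfl fun a ha => ?_
    rw [Finset.prod_pow, Finset.prod_pow, hres a ha]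
    simp only [mul_pow]
  have hsum : ∑ a ∈ Finset.Icc 1 d, mm a = ∑ a ∈ Finset.Icc 1 d, (mm a - 1) + d := by
    rw [← Finset.sum_congr rfl fun a ha => Nat.sub_add_cancel (hmm a ha),
      Finset.sum_add_distrib]
    simp
  have hξpow : ∏ a ∈ Finset.Icc 1 d, ξ a ^ (2 * (m + (mm a : ℤ) - 1)) =
      (∏ a ∈ Finset.Icc 1 d, ξ a ^ (2 * m)) *
        ∏ a ∈ Finset.Icc 1 d, (ξ a ^ 2) ^ (mm a - 1) := by
    rw [← Finset.prod_mul_distrib]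
    refine Finset.prod_congr rfl fun a ha => ?_
    have hcast : ((mm a - 1 : ℕ) : ℤ) = mm a - 1 := by
      have := hmm a ha
      omega
    rw [← pow_mul, ← zpow_natCast (ξ a), ← zpow_add₀ (hξ0 a ha)]
    congr 1
    push_cast [hcast]
    ring
  have hNpow : (N : ℂ) ^ (2 * (d : ℤ) - N) =
      (N : ℂ) ^ d * (N : ℂ) ^ (-m) * (N : ℂ)⁻¹ ^ (∑ a ∈ Finset.Icc 1 d, (mm a - 1)) := by
    rw [inv_pow, ← zpow_natCast, ← zpow_natCast, ← zpow_neg, ← zpow_add₀ hNC, ← zpow_add₀ hNC]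
    congr 1
    zify at hsum
    rw [← Nat.cast_sum] at hN
    push_cast at hN hsum ⊢
    omega
  have hsign : (-1 : ℂ) ^ (d * (∑ a ∈ Finset.Icc 1 d, mm a) + d * (d + 1) / 2) =
      (-1) ^ (d * ∑ a ∈ Finset.Icc 1 d, (mm a - 1)) * (-1) ^ (d + d * (d + 1) / 2) := by
    have hsq : (-1 : ℂ) ^ (d * d) = (-1) ^ d := by
      rw [neg_one_pow_eq_pow_mod_two, neg_one_pow_eq_pow_mod_two (n := d)]
      rcases Nat.mod_two_eq_zero_or_one d with h | h <;> simp [Nat.mul_mod, h]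
    rw [hsum, mul_add, pow_add, pow_add, hsq, pow_add, mul_assoc]
  have hdiff := prod_prod_erase_sub_eq (fun i => q i ^ 2) d
  rw [Finset.prod_mul_distrib, Finset.prod_mul_distrib, Finset.prod_mul_distrib, hq, hmix,
    hdiff, hξpow, hNpow, hsign, Finset.prod_const, Nat.card_Icc, Nat.add_sub_cancel, mul_pow]
  ring
end

section
/- Let d ≥ 1, m a nonzero integer, m₁,…,m_d positive integers, N := m + m₁ + ⋯ + m_d ≠ 0, and let ξ₁,…,ξ_d ∈ ℂ be nonzero with pairwise distinct squares. Let μ(X) := ∏_{i=1}^d (X² − ξᵢ²)^{mᵢ} and suppose q₁,…,q_d ∈ ℂ are all nonzero, satisfy ξ_a² ≠ qᵢ² for all a,i, and satisfy 2m·μ(X) + X·μ′(X) = 2N·∏_{i=1}^d (X² − ξᵢ²)^{mᵢ−1}·∏_{i=1}^d (X² − qᵢ²). For i ∈ {1,…,d} set Pᵢ := 4N·qᵢ^{2m}·∏_{a=1}^d (qᵢ² − ξ_a²)^{m_a−1}·∏_{b≠i} (qᵢ² − q_b²), and let B be the d×d matrix with entries B_{i,a} = 1/(ξ_a² − qᵢ²).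 Then ∏_{i=1}^d Pᵢ = 2^d·κ·(det B)²·∏_{a=1}^d ξ_a^{2(m+m_a+1)}·∏_{1≤a<b≤d} (ξ_a² − ξ_b²)^{m_a+m_b}, where κ = (−1)^{d² + d(N−m) + ∑_{i=1}^{d−1} i·m_{i+1}}·2^d·m^m·N^{−N}·∏_{a=1}^d m_a^{m_a+1} (integer powers of nonzero complex numbers are taken in the sense of ℤ-powers). This identity expresses the determinant of the restricted Saito metric on a B_n/D_n discriminant stratum in the coordinates ξ₁,…,ξ_d. -/
open Polynomial

theorem exists_prod_erase_sub_eq_mul_det_vandermonde_sq {R : Type*} [CommRing R] (n : ℕ) :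
    ∃ s : R, s * s = 1 ∧ ∀ v : Fin n → R,
      ∏ a, ∏ b ∈ Finset.univ.erase a, (v a - v b) = s * (Matrix.vandermonde v).det ^ 2 := by
  refine ⟨∏ i : Fin n, ∏ _j ∈ Finset.Ioi i, (-1), ?_, fun v => ?_⟩
  · simp only [← Finset.prod_mul_distrib]
    simp
  · have h := Finset.prod_prod_Ioi_mul_eq_prod_prod_off_diag (fun b a : Fin n => v a - v b)
    simp_rw [Finset.compl_singleton] at h
    rw [Matrix.det_vandermonde, sq, ← Finset.prod_mul_distrib, ← Finset.prod_mul_distrib, ← h]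
    simp_rw [← Finset.prod_mul_distrib]
    refine Finset.prod_congr rfl fun i _ => Finset.prod_congr rfl fun j _ => ?_
    ring

theorem of_eval_eq_vandermonde_mul_of_coeff {R : Type*} [CommRing R] {n : ℕ} (p : Fin n → R[X])
    (hp : ∀ a, (p a).natDegree < n) (v : Fin n → R) :
    (Matrix.of fun i a => (p a).eval (v i)) =
      Matrix.vandermonde v * Matrix.of fun k a : Fin n => (p a).coeff k := by
  ext i a
  rw [Matrix.of_apply, eval_eq_sum_range' (hp a), Matrix.mul_apply,
    ← Fin.sum_univ_eq_sum_range (fun k => (p a).coeff k * v i ^ k)]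
  simp [mul_comm]

theorem det_cauchy_sq_mul_sq {K : Type*} [Field K] {n : ℕ} {x y : Fin n → K}
    (hx : Function.Injective x) (hxy : ∀ a i, x a ≠ y i) :
    (Matrix.of fun i a : Fin n => 1 / (x a - y i)).det ^ 2 * (∏ a, ∏ i, (x a - y i)) ^ 2 =
      (∏ a, ∏ b ∈ Finset.univ.erase a, (x a - x b)) *
        ∏ i, ∏ j ∈ Finset.univ.erase i, (y i - y j) := by
  obtain ⟨s, hs, hv⟩ := exists_prod_erase_sub_eq_mul_det_vandermonde_sq (R := K) n
  set f : Fin n → K[X] := fun a => ∏ b ∈ Finset.univ.erase a, (X - C (x b)) with hf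
  have hdeg : ∀ a, (f a).natDegree < n := by
    intro a
    have := a.2
    simp only [hf, natDegree_prod_of_monic _ _ fun b _ => monic_X_sub_C (x b), natDegree_X_sub_C,
      Finset.sum_const, Finset.card_erase_of_mem (Finset.mem_univ a), Finset.card_univ,
      Fintype.card_fin, smul_eq_mul]
    lia
  set c : Matrix (Fin n) (Fin n) K := Matrix.of fun k a => (f a).coeff k
  have hc := of_eval_eq_vandermonde_mul_of_coeff f hdeg
  have h1 : (∏ a, ∏ b ∈ Finset.univ.erase a, (x a - x b)) = (Matrix.vandermonde x).det * c.det := by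
    rw [← Matrix.det_mul, ← hc, ← Matrix.det_diagonal]
    congr 1
    ext i a
    by_cases h : i = a
    · subst h
      simp [hf, eval_prod]
    · rw [Matrix.diagonal_apply_ne _ h, Matrix.of_apply, hf, eval_prod, eq_comm]
      exact Finset.prod_eq_zero (Finset.mem_erase.2 ⟨h, Finset.mem_univ i⟩) (by simp)
  have h2 : (∏ i, -∏ a, (y i - x a)) * (Matrix.of fun i a : Fin n => 1 / (x a - y i)).det =
      (Matrix.vandermonde y).det * c.det := by
    rw [← Matrix.det_mul, ← hc, ← Matrix.det_mul_column]
    congr 1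
    ext i a
    have h : x a - y i ≠ 0 := sub_ne_zero.2 (hxy a i)
    simp only [Matrix.of_apply, hf, eval_prod, eval_sub, eval_X, eval_C,
      ← Finset.mul_prod_erase Finset.univ (fun a => y i - x a) (Finset.mem_univ a)]
    field_simp
    ring
  have h3 : (∏ a, ∏ i, (x a - y i)) ^ 2 = (∏ i, -∏ a, (y i - x a)) ^ 2 := by
    rw [Finset.prod_comm, ← Finset.prod_pow, ← Finset.prod_pow]
    refine Finset.prod_congr rfl fun i _ => ?_
    rw [neg_sq, ← Finset.prod_pow, ← Finset.prod_pow]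
    exact Finset.prod_congr rfl fun a _ => by ring
  have h4 : (Matrix.vandermonde x).det ≠ 0 := Matrix.det_vandermonde_ne_zero_iff.2 hx
  have h5 : c.det = s * (Matrix.vandermonde x).det :=
    mul_left_cancel₀ h4 (by rw [← h1, hv]; ring)
  rw [h3, ← mul_pow, mul_comm (Matrix.det _), h2, h5, hv, hv]
  ring

theorem prod_Icc_prod_erase_sub_pow {R : Type*} [CommRing R] (x : ℕ → R) (k : ℕ → ℕ) (d : ℕ) :
    ∏ a ∈ Finset.Icc 1 d, ∏ b ∈ (Finset.Icc 1 d).erase a, (x a - x b) ^ k a =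
      (-1) ^ (∑ i ∈ Finset.Icc 1 (d - 1), i * k (i + 1)) *
        ∏ a ∈ Finset.Icc 1 d, ∏ b ∈ Finset.Ioc a d, (x a - x b) ^ (k a + k b) := by
  have hsum : ∀ d, ∑ i ∈ Finset.Icc 1 (d - 1), i * k (i + 1) =
      ∑ i ∈ Finset.range d, i * k (i + 1) := by
    intro d
    rcases d with _ | d
    · simp
    · rw [Finset.sum_range_succ', ← Finset.Ico_add_one_right_eq_Icc, Finset.sum_Ico_eq_sum_range]
      simp [add_comm]
  rw [hsum]
  induction d with
  | zero => simp
  | succ d ih =>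
    have e1 : (Finset.Icc 1 (d + 1)).erase (d + 1) = Finset.Icc 1 d := by
      ext; simp
    have h1 : ∀ a ∈ Finset.Icc 1 d, ∏ b ∈ (Finset.Icc 1 (d + 1)).erase a, (x a - x b) ^ k a =
        (∏ b ∈ (Finset.Icc 1 d).erase a, (x a - x b) ^ k a) * (x a - x (d + 1)) ^ k a := by
      intro a ha
      have : (Finset.Icc 1 (d + 1)).erase a = insert (d + 1) ((Finset.Icc 1 d).erase a) := by
        ext; simp at ha ⊢; lia
      rw [this, Finset.prod_insert (by simp), mul_comm]
    have h2 : ∀ a ∈ Finset.Icc 1 d, ∏ b ∈ Finset.Ioc a (d + 1), (x a - x b) ^ (k a + k b) =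
        (∏ b ∈ Finset.Ioc a d, (x a - x b) ^ (k a + k b)) *
          (x a - x (d + 1)) ^ (k a + k (d + 1)) := by
      intro a ha
      exact Finset.prod_Ioc_succ_top (Finset.mem_Icc.1 ha).2 _
    have h3 : ∏ b ∈ Finset.Icc 1 d, (x (d + 1) - x b) ^ k (d + 1) =
        (-1) ^ (d * k (d + 1)) * ∏ b ∈ Finset.Icc 1 d, (x b - x (d + 1)) ^ k (d + 1) := by
      have h := Finset.prod_const (s := Finset.Icc 1 d) ((-1 : R) ^ k (d + 1))
      rw [Nat.card_Icc, Nat.add_sub_cancel] at h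
      rw [mul_comm d, pow_mul, ← h, ← Finset.prod_mul_distrib]
      refine Finset.prod_congr rfl fun b _ => ?_
      rw [← mul_pow, neg_one_mul, neg_sub]
    rw [Finset.prod_Icc_succ_top (by lia), Finset.prod_Icc_succ_top (by lia), e1,
      Finset.prod_congr rfl h1, Finset.prod_congr rfl h2, Finset.prod_mul_distrib,
      Finset.prod_mul_distrib, ih, h3, Finset.sum_range_succ]
    simp only [pow_add, Finset.prod_mul_distrib, Finset.Ioc_self, Finset.prod_empty]
    ring

theorem mul_prod_sub_eq_of_derivative_factorization {ι K : Type*} [DecidableEq ι] [Field K]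
    [CharZero K]
    (s : Finset ι) (m N : K) (k : ι → ℕ) (hk : ∀ i ∈ s, 0 < k i) (x y : ι → K)
    (h : C (2 * m) * (∏ i ∈ s, (X ^ 2 - C (x i)) ^ k i) +
        X * (∏ i ∈ s, (X ^ 2 - C (x i)) ^ k i).derivative =
      C (2 * N) * (∏ i ∈ s, (X ^ 2 - C (x i)) ^ (k i - 1)) * ∏ i ∈ s, (X ^ 2 - C (y i)))
    (t : K) :
    m * ∏ i ∈ s, (t ^ 2 - x i) +
      t ^ 2 * ∑ a ∈ s, k a * ∏ i ∈ s.erase a, (t ^ 2 - x i) = N * ∏ i ∈ s, (t ^ 2 - y i) := by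
  set G : K[X] := ∏ i ∈ s, (X ^ 2 - C (x i)) ^ (k i - 1) with hG
  have hG0 : G ≠ 0 := (monic_prod_of_monic _ _ fun i _ =>
    (monic_X_pow_sub_C (x i) two_ne_zero).pow _).ne_zero
  have e : ∀ i ∈ s, (X ^ 2 - C (x i)) ^ k i = (X ^ 2 - C (x i)) ^ (k i - 1) * (X ^ 2 - C (x i)) :=
    fun i hi => by rw [← pow_succ, Nat.sub_add_cancel (hk i hi)]
  have h1 : ∏ i ∈ s, (X ^ 2 - C (x i)) ^ k i = G * ∏ i ∈ s, (X ^ 2 - C (x i)) := by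
    rw [Finset.prod_congr rfl e, Finset.prod_mul_distrib]
  have h2 : (∏ i ∈ s, (X ^ 2 - C (x i)) ^ k i).derivative =
      G * (2 * X * ∑ a ∈ s, C (k a : K) * ∏ i ∈ s.erase a, (X ^ 2 - C (x i))) := by
    rw [derivative_prod_finset, Finset.mul_sum, Finset.mul_sum]
    refine Finset.sum_congr rfl fun a ha => ?_
    rw [Finset.prod_congr rfl fun i hi => e i (Finset.mem_of_mem_erase hi),
      Finset.prod_mul_distrib, hG, ← Finset.mul_prod_erase s _ ha, derivative_pow]
    simp
    ring
  rw [h2, h1] at h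
  have h3 := mul_left_cancel₀ hG0 (a := G)
    (b := C (2 * m) * ∏ i ∈ s, (X ^ 2 - C (x i)) +
      X * (2 * X * ∑ a ∈ s, C (k a : K) * ∏ i ∈ s.erase a, (X ^ 2 - C (x i))))
    (c := C (2 * N) * ∏ i ∈ s, (X ^ 2 - C (y i))) (by linear_combination h)
  have h4 := congrArg (eval t) h3
  simp only [eval_add, eval_mul, eval_C, eval_prod, eval_sub, eval_pow, eval_X, eval_finsetSum,
    eval_ofNat] at h4
  exact mul_left_cancel₀ two_ne_zero (by linear_combination h4)

theorem Fin.prod_univ_add_one_eq_prod_Icc {M : Type*} [CommMonoid M] (f : ℕ → M) (d : ℕ) :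
    ∏ i : Fin d, f (i + 1) = ∏ i ∈ Finset.Icc 1 d, f i := by
  rw [Fin.prod_univ_eq_prod_range (fun i => f (i + 1)), ← Finset.Ico_add_one_right_eq_Icc,
    Finset.prod_Ico_eq_prod_range]
  simp [add_comm]

theorem Fin.prod_prod_erase_add_one_eq_prod_Icc {M : Type*} [CommMonoid M] (f : ℕ → ℕ → M)
    (d : ℕ) :
    ∏ i : Fin d, ∏ j ∈ Finset.univ.erase i, f (i + 1) (j + 1) =
      ∏ i ∈ Finset.Icc 1 d, ∏ j ∈ (Finset.Icc 1 d).erase i, f i j := by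
  rw [← Fin.prod_univ_add_one_eq_prod_Icc]
  refine Finset.prod_congr rfl fun i _ => ?_
  refine Finset.prod_bij (fun j _ => j.1 + 1) ?_ ?_ ?_ fun _ _ => rfl
  · intro j hj
    have := j.2
    simp [Fin.ext_iff] at hj ⊢
    lia
  · intro j _ j' _ h
    exact Fin.ext (Nat.succ_injective h)
  · intro b hb
    simp at hb
    exact ⟨⟨b - 1, by lia⟩, by simp [Fin.ext_iff]; lia, by simp; lia⟩

theorem det_cauchy_sq_mul_sq_Icc {K : Type*} [Field K] {d : ℕ} {x y : ℕ → K}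
    (hx : Set.InjOn x (Finset.Icc 1 d))
    (hxy : ∀ a ∈ Finset.Icc 1 d, ∀ i ∈ Finset.Icc 1 d, x a ≠ y i) :
    (Matrix.of fun i a : Fin d => 1 / (x (a + 1) - y (i + 1))).det ^ 2 *
        (∏ a ∈ Finset.Icc 1 d, ∏ i ∈ Finset.Icc 1 d, (x a - y i)) ^ 2 =
      (∏ a ∈ Finset.Icc 1 d, ∏ b ∈ (Finset.Icc 1 d).erase a, (x a - x b)) *
        ∏ i ∈ Finset.Icc 1 d, ∏ j ∈ (Finset.Icc 1 d).erase i, (y i - y j) := by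
  have hmem : ∀ a : Fin d, a.1 + 1 ∈ Finset.Icc 1 d := fun a => by simp
  simp_rw [← Fin.prod_prod_erase_add_one_eq_prod_Icc, ← Fin.prod_univ_add_one_eq_prod_Icc]
  exact det_cauchy_sq_mul_sq (x := fun a : Fin d => x (a + 1)) (y := fun i : Fin d => y (i + 1))
    (fun a b h => Fin.ext (Nat.succ_injective (hx (hmem a) (hmem b) h)))
    fun a i => hxy _ (hmem a) _ (hmem i)

theorem stmt10 (d : ℕ) (hd : 1 ≤ d) (m : ℤ) (hm0 : m ≠ 0) (mm : ℕ → ℕ)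
    (hmm : ∀ i ∈ Finset.Icc 1 d, 0 < mm i)
    (N : ℤ) (hN : N = m + ∑ i ∈ Finset.Icc 1 d, (mm i : ℤ)) (hN0 : N ≠ 0)
    (ξ : ℕ → ℂ) (hξ0 : ∀ a ∈ Finset.Icc 1 d, ξ a ≠ 0)
    (hξ : ∀ a ∈ Finset.Icc 1 d, ∀ b ∈ Finset.Icc 1 d, a ≠ b → ξ a ^ 2 ≠ ξ b ^ 2)
    (q : ℕ → ℂ) (hq0 : ∀ i ∈ Finset.Icc 1 d, q i ≠ 0)
    (hξq : ∀ a ∈ Finset.Icc 1 d, ∀ i ∈ Finset.Icc 1 d, ξ a ^ 2 ≠ q i ^ 2)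
    (hfact : C (2 * (m : ℂ)) * (∏ i ∈ Finset.Icc 1 d, (X ^ 2 - C (ξ i ^ 2)) ^ mm i) +
        X * (∏ i ∈ Finset.Icc 1 d, (X ^ 2 - C (ξ i ^ 2)) ^ mm i).derivative =
      C (2 * (N : ℂ)) *
        (∏ i ∈ Finset.Icc 1 d, (X ^ 2 - C (ξ i ^ 2)) ^ (mm i - 1)) *
        ∏ i ∈ Finset.Icc 1 d, (X ^ 2 - C (q i ^ 2))) :
    ∏ i ∈ Finset.Icc 1 d,
        (4 * (N : ℂ) * q i ^ (2 * m) *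
          (∏ a ∈ Finset.Icc 1 d, (q i ^ 2 - ξ a ^ 2) ^ (mm a - 1)) *
          ∏ b ∈ (Finset.Icc 1 d).erase i, (q i ^ 2 - q b ^ 2)) =
      2 ^ d *
        ((-1 : ℂ) ^ ((d : ℤ) ^ 2 + d * (N - m) +
              ∑ i ∈ Finset.Icc 1 (d - 1), (i : ℤ) * mm (i + 1)) *
          2 ^ d * (m : ℂ) ^ m * (N : ℂ) ^ (-N) *
          ∏ a ∈ Finset.Icc 1 d, (mm a : ℂ) ^ (mm a + 1)) *
        (Matrix.of fun i a : Fin d =>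
            1 / (ξ (a.1 + 1) ^ 2 - q (i.1 + 1) ^ 2)).det ^ 2 *
        (∏ a ∈ Finset.Icc 1 d, ξ a ^ (2 * (m + (mm a : ℤ) + 1))) *
        ∏ a ∈ Finset.Icc 1 d, ∏ b ∈ Finset.Ioc a d,
          (ξ a ^ 2 - ξ b ^ 2) ^ (mm a + mm b) := by
  have hN0' : (N : ℂ) ≠ 0 := Int.cast_ne_zero.2 hN0
  have heval := mul_prod_sub_eq_of_derivative_factorization (Finset.Icc 1 d) (m : ℂ) N mm hmm
    (fun i => ξ i ^ 2) (fun i => q i ^ 2) hfact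
  have hcauchy := det_cauchy_sq_mul_sq_Icc (d := d) (x := fun i => ξ i ^ 2)
    (y := fun i => q i ^ 2) (fun a ha b hb h => by_contra fun hab => hξ a ha b hb hab h) hξq
  have hpairs := prod_Icc_prod_erase_sub_pow (fun i => ξ i ^ 2) mm d
  have hcard : (Finset.Icc 1 d).card = d := by simp
  set s := Finset.Icc 1 d with hs
  set x : ℕ → ℂ := fun i => ξ i ^ 2 with hx
  set y : ℕ → ℂ := fun i => q i ^ 2 with hy
  set E : ℕ → ℂ := fun a => ∏ b ∈ s.erase a, (x a - x b) with hE
  set R : ℕ → ℂ := fun a => ∏ i ∈ s, (x a - y i) with hR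
  have hx0 : ∀ a ∈ s, x a ≠ 0 := fun a ha => pow_ne_zero 2 (hξ0 a ha)
  have hR0 : (∏ a ∈ s, R a) ^ 2 ≠ 0 := pow_ne_zero 2 (Finset.prod_ne_zero_iff.2 fun a ha =>
    Finset.prod_ne_zero_iff.2 fun i hi => sub_ne_zero.2 (hξq a ha i hi))
  have hprod : ∏ i ∈ s, y i = m / N * ∏ a ∈ s, x a := by
    have h := heval 0
    simp only [ne_eq, OfNat.ofNat_ne_zero, not_false_eq_true, zero_pow, zero_mul, add_zero,
      zero_sub, Finset.prod_neg] at h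
    have h' : ((-1 : ℂ) ^ s.card) ≠ 0 := pow_ne_zero _ (by norm_num)
    field_simp
    exact mul_left_cancel₀ h' (by linear_combination -h)
  have hres : ∀ a ∈ s, R a = mm a * x a * E a / N := by
    intro a ha
    have h := heval (ξ a)
    rw [Finset.prod_eq_zero ha (sub_self _), mul_zero, zero_add,
      Finset.sum_eq_single_of_mem a ha fun b hb hba => by
        rw [Finset.prod_eq_zero (Finset.mem_erase.2 ⟨hba.symm, ha⟩) (sub_self _), mul_zero]] at h
    rw [eq_div_iff hN0']
    linear_combination -h
  have hyx : (∏ i ∈ s, ∏ a ∈ s, (y i - x a) ^ (mm a - 1)) * (∏ a ∈ s, R a) ^ 2 =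
      ∏ a ∈ s, ((-1) ^ d) ^ (mm a - 1) * R a ^ (mm a + 1) := by
    rw [Finset.prod_comm, ← Finset.prod_pow, ← Finset.prod_mul_distrib]
    refine Finset.prod_congr rfl fun a ha => ?_
    have h : ∏ i ∈ s, (y i - x a) = (-1) ^ d * R a := by
      rw [← hcard, hR, ← Finset.prod_neg]
      simp
    have hk : mm a + 1 = mm a - 1 + 2 := by have := hmm a ha; lia
    rw [Finset.prod_pow, h, hk, mul_pow, pow_add]
    ring
  have hsgn : (-1 : ℂ) ^ ((d : ℤ) ^ 2 + d * (N - m) +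
      ∑ i ∈ Finset.Icc 1 (d - 1), (i : ℤ) * mm (i + 1)) =
      (∏ a ∈ s, ((-1) ^ d) ^ (mm a - 1)) *
        (-1) ^ (∑ i ∈ Finset.Icc 1 (d - 1), i * mm (i + 1)) := by
    have h : ∑ a ∈ s, (mm a : ℤ) = ((∑ a ∈ s, (mm a - 1) + d : ℕ) : ℤ) := by
      have := Finset.sum_congr (rfl : s = s) fun a ha => Nat.sub_add_cancel (hmm a ha)
      simp only [Finset.sum_add_distrib, Finset.sum_const, hcard, smul_eq_mul, Nat.succ_eq_add_one,
        zero_add, mul_one] at this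
      rw [this]
      push_cast
      rfl
    have h' : (d : ℤ) ^ 2 + d * (N - m) + ∑ i ∈ Finset.Icc 1 (d - 1), (i : ℤ) * mm (i + 1) =
        ((2 * d ^ 2 + d * ∑ a ∈ s, (mm a - 1) +
          ∑ i ∈ Finset.Icc 1 (d - 1), i * mm (i + 1) : ℕ) : ℤ) := by
      rw [hN, h]
      push_cast
      ring
    rw [h', zpow_natCast, pow_add, pow_add, pow_mul, pow_mul, Finset.prod_pow_eq_pow_sum]
    norm_num
  have hNpow : (N : ℂ) ^ (-N) = N ^ d * ((N : ℂ) ^ m)⁻¹ * (∏ a ∈ s, (N : ℂ) ^ (mm a + 1))⁻¹ := by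
    have h : ∑ a ∈ s, (mm a : ℤ) = N - m := by lia
    rw [Finset.prod_pow_eq_pow_sum, Finset.sum_add_distrib, Finset.sum_const, hcard,
      ← zpow_natCast, ← zpow_natCast, ← zpow_neg, ← zpow_neg, ← zpow_add₀ hN0', ← zpow_add₀ hN0']
    congr 1
    push_cast
    rw [h]
    simp
    ring
  have hRpow : ∏ a ∈ s, R a ^ (mm a + 1) = (∏ a ∈ s, (mm a : ℂ) ^ (mm a + 1)) *
      (∏ a ∈ s, x a ^ (mm a + 1)) * ((∏ a ∈ s, E a ^ mm a) * ∏ a ∈ s, E a) *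
        (∏ a ∈ s, (N : ℂ) ^ (mm a + 1))⁻¹ := by
    simp only [← Finset.prod_mul_distrib, ← Finset.prod_inv_distrib]
    refine Finset.prod_congr rfl fun a ha => ?_
    rw [hres a ha, div_pow, mul_pow, mul_pow, div_eq_mul_inv, pow_succ (E a)]
  have hxpow : ∏ a ∈ s, ξ a ^ (2 * (m + (mm a : ℤ) + 1)) =
      (∏ a ∈ s, x a) ^ m * ∏ a ∈ s, x a ^ (mm a + 1) := by
    rw [← Finset.prod_zpow, ← Finset.prod_mul_distrib]
    refine Finset.prod_congr rfl fun a ha => ?_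
    rw [zpow_mul, add_assoc, ← zpow_natCast (x a), ← zpow_add₀ (hx0 a ha)]
    norm_cast
  have hqpow : ∏ i ∈ s, q i ^ (2 * m) = (m : ℂ) ^ m * ((N : ℂ) ^ m)⁻¹ * (∏ a ∈ s, x a) ^ m := by
    rw [← div_eq_mul_inv, ← div_zpow, ← mul_zpow, ← hprod, ← Finset.prod_zpow]
    refine Finset.prod_congr rfl fun i _ => ?_
    rw [zpow_mul]
    norm_cast
  have hEpow : ∏ a ∈ s, E a ^ mm a = (-1) ^ (∑ i ∈ Finset.Icc 1 (d - 1), i * mm (i + 1)) *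
      ∏ a ∈ s, ∏ b ∈ Finset.Ioc a d, (x a - x b) ^ (mm a + mm b) := by
    rw [← hpairs]
    exact Finset.prod_congr rfl fun a _ => (Finset.prod_pow _ _ _).symm
  have hfour : (4 : ℂ) ^ d = 2 ^ d * 2 ^ d := by rw [← mul_pow]; norm_num
  refine mul_right_cancel₀ hR0 ?_
  rw [Finset.prod_mul_distrib, Finset.prod_mul_distrib, Finset.prod_mul_distrib, Finset.prod_const,
    hcard, mul_pow, hqpow, hfour, hsgn, hNpow, hxpow]
  rw [Finset.prod_mul_distrib, hRpow, hEpow] at hyx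
  linear_combination (2 ^ d * 2 ^ d * (N : ℂ) ^ d * ((m : ℂ) ^ m * ((N : ℂ) ^ m)⁻¹ *
    (∏ a ∈ s, x a) ^ m) * (∏ i ∈ s, ∏ j ∈ s.erase i, (y i - y j))) * hyx -
    (2 ^ d * 2 ^ d * (N : ℂ) ^ d * ((m : ℂ) ^ m * ((N : ℂ) ^ m)⁻¹ * (∏ a ∈ s, x a) ^ m) *
      (∏ a ∈ s, (N : ℂ) ^ (mm a + 1))⁻¹ * (∏ a ∈ s, ((-1) ^ d) ^ (mm a - 1)) *
      (-1) ^ (∑ i ∈ Finset.Icc 1 (d - 1), i * mm (i + 1)) *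
      (∏ a ∈ s, (mm a : ℂ) ^ (mm a + 1)) * (∏ a ∈ s, x a ^ (mm a + 1)) *
      ∏ a ∈ s, ∏ b ∈ Finset.Ioc a d, (x a - x b) ^ (mm a + mm b)) * hcauchy
end

section
/- Let d ≥ 1, m a natural number with m ≥ 1, m₁,…,m_d positive integers, N := m + m₁ + ⋯ + m_d, ξ₁,…,ξ_d ∈ ℂ, and let μ(X) := ∏_{i=1}^d (X² − ξᵢ²)^{mᵢ}. Suppose q₁,…,q_d ∈ ℂ satisfy 2m·μ(X) + X·μ′(X) = 2N·∏_{i=1}^d (X² − ξᵢ²)^{mᵢ−1}·∏_{i=1}^d (X² − qᵢ²), and set λ(X) := X^{2m}·μ(X) ∈ ℂ[X]. Then for every l ∈ {1,…,d}, the second formal derivative satisfies λ″(q_l) = 4N·q_l^{2m}·∏_{a=1}^d (q_l² − ξ_a²)^{m_a−1}·∏_{b≠l} (q_l² − q_b²). -/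
open Polynomial

theorem stmt11 (d : ℕ) (hd : 1 ≤ d) (m : ℕ) (hm : 1 ≤ m) (mm : ℕ → ℕ)
    (hmm : ∀ i ∈ Finset.Icc 1 d, 0 < mm i)
    (N : ℕ) (hN : N = m + ∑ i ∈ Finset.Icc 1 d, mm i)
    (ξ : ℕ → ℂ) (q : ℕ → ℂ)
    (hfact : C (2 * (m : ℂ)) * (∏ i ∈ Finset.Icc 1 d, (X ^ 2 - C (ξ i ^ 2)) ^ mm i) +
        X * (∏ i ∈ Finset.Icc 1 d, (X ^ 2 - C (ξ i ^ 2)) ^ mm i).derivative =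
      C (2 * (N : ℂ)) *
        (∏ i ∈ Finset.Icc 1 d, (X ^ 2 - C (ξ i ^ 2)) ^ (mm i - 1)) *
        ∏ i ∈ Finset.Icc 1 d, (X ^ 2 - C (q i ^ 2))) :
    ∀ l ∈ Finset.Icc 1 d,
      (derivative (derivative
          (X ^ (2 * m) * ∏ i ∈ Finset.Icc 1 d, (X ^ 2 - C (ξ i ^ 2)) ^ mm i))).eval (q l) =
        4 * (N : ℂ) * q l ^ (2 * m) *
          (∏ a ∈ Finset.Icc 1 d, (q l ^ 2 - ξ a ^ 2) ^ (mm a - 1)) *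
          ∏ b ∈ (Finset.Icc 1 d).erase l, (q l ^ 2 - q b ^ 2) := by
  intro l hl
  obtain ⟨k, rfl⟩ : ∃ k, m = k + 1 := ⟨m - 1, by omega⟩
  set μ : ℂ[X] := ∏ i ∈ Finset.Icc 1 d, (X ^ 2 - C (ξ i ^ 2)) ^ mm i
  have hderiv : derivative (X ^ (2 * (k + 1)) * μ) =
      X ^ (2 * k + 1) * (C (2 * ((k + 1 : ℕ) : ℂ)) * μ + X * derivative μ) := by
    rw [derivative_mul, derivative_X_pow, show 2 * (k + 1) - 1 = 2 * k + 1 by omega]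
    push_cast
    ring
  rw [hderiv, hfact, ← Finset.mul_prod_erase _ (fun i => X ^ 2 - C (q i ^ 2)) hl]
  simp only [derivative_mul, derivative_sub, derivative_X_sq, derivative_C, eval_add, eval_mul,
    eval_sub, eval_pow, eval_X, eval_C, eval_prod, eval_zero]
  ring
end

section
/- Let t, Q_l, Q_m be polynomials in n variables over ℂ and let α_l, α_m ∈ ℂ^n with (α_l, α_m) ≠ 0. Suppose that ∂_{α_l} t = L_{α_l}·Q_l and ∂_{α_m} t = L_{α_m}·Q_m as polynomials, where L_v denotes the linear polynomial x ↦ (v,x). Then Q_l(x) = Q_m(x) for every x ∈ ℂ^n with (α_l, x) = 0 and (α_m, x) = 0. -/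
open MvPolynomial

/-- The standard bilinear form `(u,v) = ∑ i, uᵢ vᵢ` on `ℂ^n`. -/
noncomputable def bform {n : ℕ} (u v : Fin n → ℂ) : ℂ := ∑ i, u i * v i

/-- The directional derivative `∂_v p = ∑ i, vᵢ ∂p/∂xᵢ` of a polynomial in `n` variables. -/
noncomputable def dirDeriv {n : ℕ} (v : Fin n → ℂ) (p : MvPolynomial (Fin n) ℂ) :
    MvPolynomial (Fin n) ℂ :=
  ∑ i, MvPolynomial.C (v i) * MvPolynomial.pderiv i p

/-- The linear polynomial `x ↦ (v, x)`. -/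
noncomputable def linForm {n : ℕ} (v : Fin n → ℂ) : MvPolynomial (Fin n) ℂ :=
  ∑ i, MvPolynomial.C (v i) * MvPolynomial.X i

theorem dirDeriv_eq_mkDerivation {n : ℕ} (v : Fin n → ℂ) (p : MvPolynomial (Fin n) ℂ) :
    dirDeriv v p = mkDerivation ℂ (fun i => (C (v i) : MvPolynomial (Fin n) ℂ)) p := by
  have sum_apply (q : MvPolynomial (Fin n) ℂ) :
      (∑ i, (C (v i) : MvPolynomial (Fin n) ℂ) • pderiv i : Derivation ℂ _ _) q =
        dirDeriv v q := by
    change Derivation.coeFnAddMonoidHom _ q = _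
    simp [dirDeriv, Derivation.coeFnAddMonoidHom]
  rw [← sum_apply]
  congr 1
  refine derivation_ext fun j => ?_
  rw [sum_apply]
  simp [dirDeriv, mkDerivation_X, pderiv_X, Pi.single_apply]

theorem dirDeriv_comm {n : ℕ} (u v : Fin n → ℂ) (p : MvPolynomial (Fin n) ℂ) :
    dirDeriv u (dirDeriv v p) = dirDeriv v (dirDeriv u p) := by
  simp only [dirDeriv_eq_mkDerivation]
  rw [← sub_eq_zero, ← Derivation.commutator_apply]
  have h : ⁅mkDerivation ℂ (fun i => (C (u i) : MvPolynomial (Fin n) ℂ)),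
      mkDerivation ℂ (fun i => (C (v i) : MvPolynomial (Fin n) ℂ))⁆ = 0 :=
    derivation_ext fun i => by
      simp [Derivation.commutator_apply, mkDerivation_X, derivation_C]
  rw [h, Derivation.zero_apply]

theorem dirDeriv_mul {n : ℕ} (v : Fin n → ℂ) (p q : MvPolynomial (Fin n) ℂ) :
    dirDeriv v (p * q) = p * dirDeriv v q + q * dirDeriv v p := by
  simp only [dirDeriv_eq_mkDerivation, Derivation.leibniz, smul_eq_mul]

theorem dirDeriv_linForm {n : ℕ} (u v : Fin n → ℂ) :
    dirDeriv u (linForm v) = C (bform v u) := by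
  simp [dirDeriv_eq_mkDerivation, linForm, bform, mkDerivation_X, derivation_C]

theorem eval_linForm {n : ℕ} (v x : Fin n → ℂ) : eval x (linForm v) = bform v x := by
  simp [linForm, bform]

theorem bform_comm {n : ℕ} (u v : Fin n → ℂ) : bform u v = bform v u := by
  simp only [bform, mul_comm]

theorem stmt12 {n : ℕ} (t Ql Qm : MvPolynomial (Fin n) ℂ) (αl αm : Fin n → ℂ)
    (hlm : bform αl αm ≠ 0)
    (hl : dirDeriv αl t = linForm αl * Ql)
    (hm : dirDeriv αm t = linForm αm * Qm)
    (x : Fin n → ℂ) (hxl : bform αl x = 0) (hxm : bform αm x = 0) :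
    MvPolynomial.eval x Ql = MvPolynomial.eval x Qm := by
  have h := congrArg (eval x) (dirDeriv_comm αm αl t)
  simp only [hl, hm, dirDeriv_mul, dirDeriv_linForm, map_add, map_mul, eval_linForm, hxl, hxm,
    zero_mul, zero_add, eval_C, bform_comm αm αl] at h
  exact mul_right_cancel₀ hlm h
end

section
/- Let n ≥ 2, let α₁,…,α_n ∈ ℂ^n, fix k ∈ {1,…,n}, and let p¹,…,p^{n−1} be polynomials in n variables over ℂ. Let α ∈ ℂ^n be a nonzero vector with (α,α) ≠ 0 which lies in the linear span of {α_j : j ≠ k}, and suppose each pⁱ is s_α-invariant. Then the determinant J_k(x) := det((∂_{α_j} pⁱ)(x))_{1≤i≤n−1, j≠k} (rows indexed by i = 1,…,n−1, columns indexed by j ∈ {1,…,n}∖{k} in increasing order) vanishes at every point x ∈ ℂ^n with (α,x) = 0. -/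
open MvPolynomial

/-- The reflection `s_α(x) = x − (2(α,x)/(α,α))·α` in the hyperplane orthogonal to `α`. -/
noncomputable def reflect {n : ℕ} (α x : Fin n → ℂ) : Fin n → ℂ :=
  fun i => x i - (2 * bform α x / bform α α) * α i

/-- Restricting `p` to the line `t ↦ x + t v` gives a univariate polynomial in `t`. -/
theorem eval_aeval_line {n : ℕ} (v x : Fin n → ℂ) (p : MvPolynomial (Fin n) ℂ) (t : ℂ) :
    (aeval (fun i => Polynomial.C (x i) + Polynomial.C (v i) * Polynomial.X) p).eval t
      = eval (x + t • v) p := by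
  induction p using MvPolynomial.induction_on with
  | C a => simp
  | add p q hp hq => simp [hp, hq]
  | mul_X p i hp => simp [hp, mul_comm t]

/-- The derivative of `p` along the line `t ↦ x + t v` at `t = 0` is the directional derivative. -/
theorem eval_zero_derivative_line {n : ℕ} (v x : Fin n → ℂ) (p : MvPolynomial (Fin n) ℂ) :
    (Polynomial.derivative (aeval (fun i => Polynomial.C (x i) + Polynomial.C (v i) * Polynomial.X)
      p)).eval 0 = eval x (dirDeriv v p) := by
  induction p using MvPolynomial.induction_on with
  | C a => simp [dirDeriv]
  | add p q hp hq => simp [hp, hq, dirDeriv, mul_add, Finset.sum_add_distrib]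
  | mul_X p i hp =>
    simp only [map_mul, aeval_X, Polynomial.derivative_mul, Polynomial.eval_add,
      Polynomial.eval_mul, hp, eval_aeval_line, zero_smul, add_zero]
    simp [dirDeriv, pderiv_X, Pi.single_apply, mul_add, Finset.sum_add_distrib,
      Finset.sum_mul, apply_ite]
    simp only [mul_comm, mul_left_comm, add_comm]

/-- A point on the line through the mirror in direction `α` is reflected to its opposite. -/
theorem reflect_add_smul {n : ℕ} {α x : Fin n → ℂ} (hαα : bform α α ≠ 0) (hx : bform α x = 0)
    (t : ℂ) : reflect α (x + t • α) = x + (-t) • α := by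
  have h : bform α (x + t • α) = t * bform α α := by
    have : bform α (x + t • α) = bform α x + t * bform α α := by
      simp only [bform, Pi.add_apply, Pi.smul_apply, smul_eq_mul, mul_add, Finset.sum_add_distrib,
        Finset.mul_sum, mul_left_comm]
    rw [this, hx, zero_add]
  ext i
  simp only [reflect, h, Pi.add_apply, Pi.smul_apply, smul_eq_mul]
  field_simp
  ring

/-- An `s_α`-invariant polynomial has vanishing derivative along `α` on the mirror of `s_α`. -/
theorem eval_dirDeriv_eq_zero_of_invariant {n : ℕ} {α x : Fin n → ℂ} (hαα : bform α α ≠ 0)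
    (hx : bform α x = 0) {p : MvPolynomial (Fin n) ℂ}
    (hinv : ∀ y : Fin n → ℂ, MvPolynomial.eval (reflect α y) p = MvPolynomial.eval y p) :
    MvPolynomial.eval x (dirDeriv α p) = 0 := by
  rw [← eval_zero_derivative_line]
  set q : Polynomial ℂ := MvPolynomial.aeval
    (fun i => Polynomial.C (x i) + Polynomial.C (α i) * Polynomial.X) p
  have hline : ∀ t : ℂ, q.eval t = MvPolynomial.eval (x + t • α) p := eval_aeval_line α x p
  have hcomp : q.comp (-Polynomial.X) = q := by
    apply Polynomial.funext
    intro t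
    rw [Polynomial.eval_comp, hline, hline, ← hinv (x + t • α), reflect_add_smul hαα hx]
    simp
  have hd := congrArg (fun r => (Polynomial.derivative r).eval 0) hcomp
  simp only [Polynomial.derivative_comp, Polynomial.eval_mul, Polynomial.eval_comp,
    Polynomial.derivative_neg, Polynomial.derivative_X, Polynomial.eval_neg, Polynomial.eval_X,
    Polynomial.eval_one, neg_zero] at hd
  linear_combination (-1 / 2 : ℂ) * hd

/-- The directional derivative is linear in the direction. -/
theorem eval_dirDeriv_sum_smul {n m : ℕ} (c : Fin m → ℂ) (w : Fin m → Fin n → ℂ)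
    (x : Fin n → ℂ) (p : MvPolynomial (Fin n) ℂ) :
    MvPolynomial.eval x (dirDeriv (∑ j, c j • w j) p)
      = ∑ j, MvPolynomial.eval x (dirDeriv (w j) p) * c j := by
  simp only [dirDeriv, map_sum, map_mul, MvPolynomial.eval_C, Finset.sum_apply, Pi.smul_apply,
    smul_eq_mul, Finset.sum_mul]
  rw [Finset.sum_comm]
  refine Finset.sum_congr rfl fun i _ => Finset.sum_congr rfl fun j _ => ?_
  ring

/- Here the number of variables of the natural-language statement is `n + 1` (so that the
hypothesis `n ≥ 2` there becomes `1 ≤ n`), the `n` vectors are `αv 0, …, αv n`, and the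
`(n-1) × (n-1)` matrix defining `J_k` has rows indexed by `i : Fin n` and columns indexed by
`j ∈ {0,…,n} \ {k}` in increasing order via `k.succAbove`. -/
theorem stmt14 (n : ℕ) (hn : 1 ≤ n)
    (αv : Fin (n + 1) → (Fin (n + 1) → ℂ)) (k : Fin (n + 1))
    (p : Fin n → MvPolynomial (Fin (n + 1)) ℂ)
    (α : Fin (n + 1) → ℂ) (hα0 : α ≠ 0) (hαα : bform α α ≠ 0)
    (hspan : α ∈ Submodule.span ℂ (αv '' {j | j ≠ k}))
    (hinv : ∀ i, ∀ x : Fin (n + 1) → ℂ,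
      MvPolynomial.eval (reflect α x) (p i) = MvPolynomial.eval x (p i))
    (x : Fin (n + 1) → ℂ) (hx : bform α x = 0) :
    (Matrix.of fun i j : Fin n =>
      MvPolynomial.eval x (dirDeriv (αv (k.succAbove j)) (p i))).det = 0 := by
  have hrange : αv '' {j | j ≠ k} = Set.range fun j => αv (k.succAbove j) := by
    rw [Set.range_comp' αv k.succAbove, Fin.range_succAbove]
    rfl
  rw [hrange, Submodule.mem_span_range_iff_exists_fun] at hspan
  obtain ⟨c, hc⟩ := hspan
  refine Matrix.exists_mulVec_eq_zero_iff.mp ⟨c, ?_, ?_⟩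
  · rintro rfl
    exact hα0 (by simpa using hc.symm)
  · ext i
    have h := eval_dirDeriv_eq_zero_of_invariant hαα hx (hinv i)
    rw [← hc, eval_dirDeriv_sum_smul] at h
    simpa [Matrix.mulVec, dotProduct] using h
end

section
/- Let n ≥ 1, d ≥ 0, and let b : {1,…,n+1} → {0,1,…,d} be any map. Set R_D := {eᵢ − e_j : i ≠ j and b(i) = b(j)} ⊆ A_n. Let k, l ∈ {1,…,n+1} with b(k) ≠ b(l) and β := e_k − e_l. Then span(R_D ∪ {β}) ∩ A_n = {eᵢ − e_j : i ≠ j and (b(i) = b(j) or {b(i), b(j)} ⊆ {b(k), b(l)})}, where span denotes the linear span in ℝ^{n+1}. -/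
/-- If `g` takes equal values at the endpoints of every difference `eᵢ - eⱼ` lying in `S`, then it
does so for every difference `eᵢ - eⱼ` lying in the span of `S`. -/
theorem eq_of_single_sub_single_mem_span {ι : Type*} [Fintype ι] [DecidableEq ι]
    {S : Set (ι → ℝ)} (g : ι → ℝ)
    (hS : ∀ α ∈ S, ∃ i j, g i = g j ∧ α = Pi.single i 1 - Pi.single j 1) {i j : ι}
    (h : (Pi.single i 1 - Pi.single j 1 : ι → ℝ) ∈ Submodule.span ℝ S) : g i = g j := by
  have hle : Submodule.span ℝ S ≤ LinearMap.ker (dotProductBilin ℝ ℝ g) := by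
    refine Submodule.span_le.2 fun α hα => ?_
    obtain ⟨p, q, hpq, rfl⟩ := hS α hα
    simp [hpq]
  have := hle h
  simpa [sub_eq_zero] using this


/- The root system of type `A_n` in `ℝ^{n+1}` is the set of vectors `eᵢ − e_j`, `i ≠ j`;
`R_D` is the set of roots within blocks of `b`, and `β = e_k − e_l` with `b k ≠ b l`. -/
theorem stmt18 (n d : ℕ) (hn : 1 ≤ n)
    (b : Fin (n + 1) → Fin (d + 1))
    (k l : Fin (n + 1)) (hkl : b k ≠ b l) :
    (Submodule.span ℝ
        ({α : Fin (n + 1) → ℝ |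
            ∃ i j, i ≠ j ∧ b i = b j ∧ α = Pi.single i 1 - Pi.single j 1} ∪
          {Pi.single k 1 - Pi.single l 1}) : Set (Fin (n + 1) → ℝ)) ∩
      {α : Fin (n + 1) → ℝ | ∃ i j, i ≠ j ∧ α = Pi.single i 1 - Pi.single j 1} =
    {α : Fin (n + 1) → ℝ |
      ∃ i j, i ≠ j ∧ (b i = b j ∨ ({b i, b j} : Set (Fin (d + 1))) ⊆ {b k, b l}) ∧
        α = Pi.single i 1 - Pi.single j 1} := by
  set S : Set (Fin (n + 1) → ℝ) := {α | ∃ i j, i ≠ j ∧ b i = b j ∧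
    α = Pi.single i 1 - Pi.single j 1} ∪ {Pi.single k 1 - Pi.single l 1}
  have same : ∀ i j, b i = b j →
      (Pi.single i 1 - Pi.single j 1 : Fin (n + 1) → ℝ) ∈ Submodule.span ℝ S := by
    intro i j hij
    by_cases h : i = j
    · simp [h]
    · exact Submodule.subset_span (Or.inl ⟨i, j, h, hij, rfl⟩)
  have cross : ∀ i j, b i = b k → b j = b l →
      (Pi.single i 1 - Pi.single j 1 : Fin (n + 1) → ℝ) ∈ Submodule.span ℝ S := by
    intro i j hi hj
    have hβ : (Pi.single k 1 - Pi.single l 1 : Fin (n + 1) → ℝ) ∈ Submodule.span ℝ S :=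
      Submodule.subset_span (Or.inr rfl)
    simpa using add_mem (add_mem (same i k hi) hβ) (same l j hj.symm)
  have value_eq : ∀ (f : Fin (d + 1) → ℝ), f (b k) = f (b l) → ∀ i j,
      (Pi.single i 1 - Pi.single j 1 : Fin (n + 1) → ℝ) ∈ Submodule.span ℝ S →
        f (b i) = f (b j) := by
    intro f hf i j h
    refine eq_of_single_sub_single_mem_span (fun x => f (b x)) ?_ h
    rintro α (⟨p, q, -, hpq, rfl⟩ | rfl)
    · exact ⟨p, q, congrArg f hpq, rfl⟩
    · exact ⟨k, l, hf, rfl⟩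
  ext α
  constructor
  · rintro ⟨hα, i, j, hij, rfl⟩
    refine ⟨i, j, hij, or_iff_not_imp_left.2 fun hb => ?_, rfl⟩
    have mem : ∀ c, (c = b i ∨ c = b j) → c = b k ∨ c = b l := by
      intro c hc
      by_contra! hne
      have := value_eq (Pi.single c 1) (by simp [hne.1.symm, hne.2.symm]) i j hα
      rcases hc with rfl | rfl
      · simp [Ne.symm hb] at this
      · simp [hb] at this
    exact fun c hc => mem c hc
  · rintro ⟨i, j, hij, h, rfl⟩
    refine ⟨?_, i, j, hij, rfl⟩
    rcases h with h | h
    · exact same i j h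
    · have hi : b i = b k ∨ b i = b l := h (Or.inl rfl)
      have hj : b j = b k ∨ b j = b l := h (Or.inr rfl)
      rcases hi with hi | hi <;> rcases hj with hj | hj
      · exact same i j (hi.trans hj.symm)
      · exact cross i j hi hj
      · simpa using neg_mem (cross j i hj hi)
      · exact same i j (hi.trans hj.symm)
end
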